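/- arXiv:1608.01464 — 2 statements merged into one kernel-verified Lean document; each statement's English description precedes it below -/
import Mathlib

section
/- For every n ≥ 1, the number of isomorphism classes of connected distance-hereditary simple graphs on n vertices is at most 2^(3n) = 8^n. -/
/-- A simple graph is distance-hereditary if in every connected induced subgraph,
distances agree with those in the ambient graph. -/
def DistanceHereditary {V : Type} (G : SimpleGraph V) : Prop :=
  ∀ S : Set V, (G.induce S).Connected →
    ∀ u v : S, (G.induce S).dist u v = G.dist u.val v.val

/-- The number of isomorphism classes of connected distance-hereditary simple graphs
on `n` vertices. -/
noncomputable def numConnDH (n : ℕ) : ℕ :=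
  Nat.card (Quot (fun (G G' : {G : SimpleGraph (Fin n) // G.Connected ∧ DistanceHereditary G}) =>
    Nonempty (G.val ≃g G'.val)))

section Pruning

variable {V : Type}

namespace SimpleGraph

/-- Two distinct vertices are twins if no third vertex is adjacent to exactly one of them. -/
def AreTwins (G : SimpleGraph V) (u v : V) : Prop :=
  u ≠ v ∧ ∀ w, w ≠ u → w ≠ v → (G.Adj w u ↔ G.Adj w v)

/-- No four vertices of `A` induce a path. -/
def PathFourFreeOn (G : SimpleGraph V) (A : Set V) : Prop :=
  ∀ a ∈ A, ∀ b ∈ A, ∀ c ∈ A, ∀ d ∈ A, G.Adj a b → G.Adj b c → G.Adj c d →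
    ¬ G.Adj a c → ¬ G.Adj b d → a ≠ d → G.Adj a d

theorem PathFourFreeOn.mono {G : SimpleGraph V} {A B : Set V} (h : G.PathFourFreeOn B)
    (hAB : A ⊆ B) : G.PathFourFreeOn A :=
  fun a ha b hb c hc d hd => h a (hAB ha) b (hAB hb) c (hAB hc) d (hAB hd)

theorem PathFourFreeOn.compl {G : SimpleGraph V} {A : Set V} (h : G.PathFourFreeOn A) :
    Gᶜ.PathFourFreeOn A := by
  intro a ha b hb c hc d hd hab hbc hcd hac hbd had
  simp only [compl_adj, not_and, not_not] at *
  refine ⟨had, fun hadj => ?_⟩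
  have hca : a ≠ c := fun e => by subst e; exact hcd.2 hadj
  have hbd' : b ≠ d := fun e => by subst e; exact hab.2 hadj
  exact hbc.2 (h c hc a ha d hd b hb (hac hca).symm hadj (hbd hbd').symm
    hcd.2 hab.2 hbc.1.symm).symm

/-- Adding a vertex `v` to a set split into two parts without edges between them. -/
theorem PathFourFreeOn.exists_split_insert {G : SimpleGraph V} [DecidableEq V]
    {v : V} {B C : Finset V} (hvB : v ∉ B) (hvC : v ∉ C) (hB : B.Nonempty) (hC : C.Nonempty)
    (hBC : Disjoint B C) (hanti : ∀ b ∈ B, ∀ c ∈ C, ¬ G.Adj b c)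
    (h : G.PathFourFreeOn (insert v (B ∪ C) : Finset V)) :
    ∃ D E : Finset V, D.Nonempty ∧ E.Nonempty ∧ Disjoint D E ∧ D ∪ E = insert v (B ∪ C) ∧
      ((∀ b ∈ D, ∀ c ∈ E, ¬ G.Adj b c) ∨ (∀ b ∈ D, ∀ c ∈ E, G.Adj b c)) := by
  classical
  by_cases h1 : ∀ b ∈ B, ¬ G.Adj v b
  · refine ⟨B, insert v C, hB, by simp, by simp [hvB, hBC], by ext; simp, Or.inl ?_⟩
    intro b hb c hc
    rcases Finset.mem_insert.1 hc with rfl | hc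
    · exact fun h => h1 b hb h.symm
    · exact hanti b hb c hc
  by_cases h2 : ∀ c ∈ C, ¬ G.Adj v c
  · refine ⟨C, insert v B, hC, by simp, by simp [hvC, hBC.symm], by ext; simp; tauto, Or.inl ?_⟩
    intro c hc b hb
    rcases Finset.mem_insert.1 hb with rfl | hb
    · exact fun h => h2 c hc h.symm
    · exact fun h => hanti b hb c hc h.symm
  by_cases h3 : ∀ w ∈ B ∪ C, G.Adj v w
  · refine ⟨{v}, B ∪ C, by simp, by simp [hB], by simp [hvB, hvC], by ext; simp, Or.inr ?_⟩
    simpa using h3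
  push Not at h1 h2 h3
  obtain ⟨b₀, hb₀, hvb₀⟩ := h1
  obtain ⟨c₀, hc₀, hvc₀⟩ := h2
  obtain ⟨w₀, hw₀, hvw₀⟩ := h3
  refine ⟨(B ∪ C).filter (fun w => ¬ G.Adj v w), insert v ((B ∪ C).filter (fun w => G.Adj v w)),
    ⟨w₀, by simpa using ⟨by simpa using hw₀, hvw₀⟩⟩, by simp, ?_, ?_, Or.inl ?_⟩
  · rw [Finset.disjoint_left]
    intro x hx hx'
    simp only [Finset.mem_filter, Finset.mem_insert, Finset.mem_union] at hx hx'
    rcases hx' with rfl | hx'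
    · tauto
    · tauto
  · ext x
    simp only [Finset.mem_filter, Finset.mem_insert, Finset.mem_union]
    tauto
  · intro w hw x hx hwx
    simp only [Finset.mem_filter, Finset.mem_insert, Finset.mem_union] at hw hx
    rcases hx with rfl | ⟨hx, hvx⟩
    · exact hw.2 hwx.symm
    have key : ∀ y ∈ B ∪ C, G.Adj v y → ¬ G.Adj x y → ¬ G.Adj w y → False := by
      intro y hy hvy hxy hwy
      have hwm : w ∈ insert v (B ∪ C) := by simp [hw.1]
      have hxm : x ∈ insert v (B ∪ C) := by simp [hx]
      exact hwy (h w hwm x hxm v (by simp) y (Finset.mem_insert_of_mem hy) hwx hvx.symm hvy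
        (fun h => hw.2 h.symm) hxy (fun e => by subst e; exact hw.2 hvy))
    rcases hw.1 with hwB | hwC <;> rcases hx with hxB | hxC
    · exact key c₀ (by simp [hc₀]) hvc₀ (hanti x hxB c₀ hc₀) (hanti w hwB c₀ hc₀)
    · exact hanti w hwB x hxC hwx
    · exact hanti x hxB w hwC hwx.symm
    · exact key b₀ (by simp [hb₀]) hvb₀ (fun h => hanti b₀ hb₀ x hxC h.symm)
        (fun h => hanti b₀ hb₀ w hwC h.symm)

/-- A set with at least two vertices and no induced four-vertex path splits into two parts that
are completely joined or completely disjoined. -/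
theorem PathFourFreeOn.exists_split {G : SimpleGraph V} [DecidableEq V] (A : Finset V)
    (hA : 2 ≤ A.card) (h : G.PathFourFreeOn A) :
    ∃ D E : Finset V, D.Nonempty ∧ E.Nonempty ∧ Disjoint D E ∧ D ∪ E = A ∧
      ((∀ b ∈ D, ∀ c ∈ E, ¬ G.Adj b c) ∨ (∀ b ∈ D, ∀ c ∈ E, G.Adj b c)) := by
  induction A using Finset.induction_on with
  | empty => simp at hA
  | insert v A hv ih =>
    rw [Finset.card_insert_of_notMem hv] at hA
    rcases Nat.lt_or_ge A.card 2 with hlt | hge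
    · obtain ⟨u, rfl⟩ := Finset.card_eq_one.1 (by omega : A.card = 1)
      refine ⟨{v}, {u}, by simp, by simp, by simpa using hv, by ext; simp, ?_⟩
      by_cases hvu : G.Adj v u <;> simp [hvu]
    obtain ⟨B, C, hB, hC, hBC, rfl, hs⟩ := ih hge (h.mono (by simp))
    simp only [Finset.mem_union, not_or] at hv
    rcases hs with hs | hs
    · exact h.exists_split_insert hv.1 hv.2 hB hC hBC hs
    · obtain ⟨D, E, hD, hE, hDE, hU, hs'⟩ := h.compl.exists_split_insert hv.1 hv.2 hB hC hBC
        (fun b hb c hc hbc => ((SimpleGraph.compl_adj _ _ _).1 hbc).2 (hs b hb c hc))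
      refine ⟨D, E, hD, hE, hDE, hU, hs'.symm.imp (fun h b hb c hc => (h b hb c hc).2) ?_⟩
      intro h b hb c hc
      have := h b hb c hc
      have hne : b ≠ c := fun e => Finset.disjoint_left.1 hDE hb (e ▸ hc)
      simpa [hne] using this

/-- A module without induced four-vertex paths and with at least two vertices contains twins. -/
theorem PathFourFreeOn.exists_areTwins {G : SimpleGraph V} (A : Finset V)
    (hA : 2 ≤ A.card) (h : G.PathFourFreeOn A)
    (hmod : ∀ x ∈ A, ∀ y ∈ A, ∀ z ∉ A, G.Adj z x → G.Adj z y) :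
    ∃ u v, G.AreTwins u v := by
  classical
  induction hn : A.card using Nat.strong_induction_on generalizing A with
  | _ n ih =>
  subst hn
  obtain ⟨D, E, hD, hE, hDE, rfl, hs⟩ := h.exists_split A hA
  have hcard := Finset.card_union_of_disjoint hDE
  have hD1 := hD.card_pos
  have hE1 := hE.card_pos
  by_cases hD2 : 2 ≤ D.card
  · refine ih D.card (by omega) D hD2 (h.mono (by simp)) ?_ rfl
    intro x hx y hy z hz hzx
    by_cases hzE : z ∈ E
    · rcases hs with hs | hs
      · exact absurd hzx.symm (hs x hx z hzE)
      · exact (hs y hy z hzE).symm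
    · exact hmod x (by simp [hx]) y (by simp [hy]) z (by simp [hz, hzE]) hzx
  by_cases hE2 : 2 ≤ E.card
  · refine ih E.card (by omega) E hE2 (h.mono (by simp)) ?_ rfl
    intro x hx y hy z hz hzx
    by_cases hzD : z ∈ D
    · rcases hs with hs | hs
      · exact absurd hzx (hs z hzD x hx)
      · exact hs z hzD y hy
    · exact hmod x (by simp [hx]) y (by simp [hy]) z (by simp [hz, hzD]) hzx
  obtain ⟨u, rfl⟩ := Finset.card_eq_one.1 (by omega : D.card = 1)
  obtain ⟨v, rfl⟩ := Finset.card_eq_one.1 (by omega : E.card = 1)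
  refine ⟨u, v, by simpa using hDE, fun w hwu hwv => ⟨?_, ?_⟩⟩
  · exact hmod u (by simp) v (by simp) w (by simp [hwu, hwv])
  · exact hmod v (by simp) u (by simp) w (by simp [hwu, hwv])

theorem Walk.dist_lt_of_mem_support {G : SimpleGraph V} {r p q : V} (w : G.Walk r p)
    (hw : w.length = G.dist r p) (hq : q ∈ w.support) (hqp : q ≠ p) :
    G.dist r q < G.dist r p := by
  classical
  have h1 := congrArg Walk.length (w.take_spec hq)
  rw [Walk.length_append] at h1
  have h2 : (w.dropUntil q hq).length ≠ 0 := fun h => hqp (Walk.eq_of_length_eq_zero h)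
  have h3 := dist_le (w.takeUntil q hq)
  omega

end SimpleGraph

open SimpleGraph

namespace DistanceHereditary

variable {G : SimpleGraph V}

theorem exists_adj_mem_support (hG : DistanceHereditary G) {r y : V} (w : G.Walk r y)
    (hne : r ≠ y) : ∃ q ∈ w.support, G.Adj q y ∧ G.dist r q + 1 = G.dist r y := by
  have hc : (G.induce {v | v ∈ w.support}).Connected := w.connected_induce_support
  let r' : {v | v ∈ w.support} := ⟨r, w.start_mem_support⟩
  let y' : {v | v ∈ w.support} := ⟨y, w.end_mem_support⟩
  obtain ⟨p, hp⟩ := hc.exists_walk_length_eq_dist y' r'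
  have hd := hG _ hc y' r'
  obtain ⟨q, h, p, rfl⟩ := p.exists_eq_cons_of_ne (fun h => hne (congrArg Subtype.val h).symm)
  have h1 := hG _ hc q r'
  have h2 := dist_le p
  have h3 : G.Adj y q.1 := h
  have h4 : G.dist y r ≤ G.dist q.1 r + 1 := by
    obtain ⟨p', hp'⟩ : ∃ p' : G.Walk q.1 r, p'.length = G.dist q.1 r :=
      (p.map (Embedding.induce _).toHom).reachable.exists_walk_length_eq_dist
    have := dist_le (Walk.cons h3 p')
    rw [Walk.length_cons, hp'] at this
    exact this
  refine ⟨q.1, q.2, h3.symm, ?_⟩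
  rw [Walk.length_cons] at hp
  rw [SimpleGraph.dist_comm, SimpleGraph.dist_comm (u := r) (v := y)]
  change _ = G.dist y r at hd
  change _ = G.dist q.1 r at h1
  omega

/-- Common part of the two neighbourhood comparisons below: `w` leads from `x` to `y` inside the
levels above `p`. -/
theorem adj_of_walk (hG : DistanceHereditary G) (hc : G.Connected) {r p x y : V}
    (hpx : G.Adj p x) (hpy : G.dist r p + 1 = G.dist r y)
    (w : G.Walk x y) (hw : ∀ q ∈ w.support, G.dist r p < G.dist r q) : G.Adj p y := by
  obtain ⟨g, hg⟩ := hc.exists_walk_length_eq_dist r p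
  obtain ⟨q, hq, hqy, hd⟩ := hG.exists_adj_mem_support (g.append (Walk.cons hpx w))
    (by rintro rfl; simp at hpy)
  rw [Walk.mem_support_append_iff, Walk.support_cons, List.mem_cons] at hq
  by_cases hqp : q = p
  · exact hqp ▸ hqy
  rcases hq with hq | hq | hq
  · have := g.dist_lt_of_mem_support hg hq hqp
    omega
  · exact absurd hq hqp
  · have := hw q hq
    omega

theorem adj_of_adj_same_level (hG : DistanceHereditary G) (hc : G.Connected) {r p x y : V}
    (hpx : G.Adj p x) (hp : G.dist r p + 1 = G.dist r x) (hxy : G.Adj x y)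
    (hd : G.dist r x = G.dist r y) : G.Adj p y :=
  hG.adj_of_walk hc hpx (hp.trans hd) (Walk.cons hxy Walk.nil) (by simp; omega)

theorem adj_of_common_upper (hG : DistanceHereditary G) (hc : G.Connected) {r p x y v : V}
    (hpx : G.Adj p x) (hp : G.dist r p + 1 = G.dist r x) (hxv : G.Adj x v) (hvy : G.Adj v y)
    (hv : G.dist r x + 1 = G.dist r v) (hd : G.dist r x = G.dist r y) : G.Adj p y :=
  hG.adj_of_walk hc hpx (hp.trans hd) (Walk.cons hxv (Walk.cons hvy Walk.nil)) (by simp; omega)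

theorem dist_eq_two {a b c : V} (hab : G.Adj a b) (hbc : G.Adj b c) (hac : ¬ G.Adj a c)
    (hne : a ≠ c) : G.dist a c = 2 := by
  have h1 := dist_le (Walk.cons hab (Walk.cons hbc Walk.nil))
  have h2 : G.dist a c ≠ 1 := fun h => hac (dist_eq_one_iff_adj.1 h)
  have h3 : G.dist a c ≠ 0 := (Walk.cons hab (Walk.cons hbc Walk.nil)).reachable.pos_dist_of_ne
    hne |>.ne'
  simp only [Walk.length_cons, Walk.length_nil] at h1
  omega

theorem pathFourFreeOn_neighborSet (hG : DistanceHereditary G) (v : V) :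
    G.PathFourFreeOn (G.neighborSet v) := by
  intro a ha b _ c _ d hd hab hbc hcd hac hbd had
  by_contra hadj
  have h2 := dist_eq_two (G.adj_symm ha) hd hadj had
  obtain ⟨q, hq, hqd, hdist⟩ := hG.exists_adj_mem_support
    (Walk.cons hab (Walk.cons hbc (Walk.cons hcd Walk.nil))) had
  have hq1 : G.Adj a q := dist_eq_one_iff_adj.1 (by omega)
  simp only [Walk.support_cons, Walk.support_nil, List.mem_cons, List.not_mem_nil, or_false] at hq
  rcases hq with rfl | rfl | rfl | rfl
  · exact hadj hqd
  · exact hbd hqd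
  · exact hac hq1
  · exact hqd.ne rfl

/-- Two vertices at distance two with a common neighbour `x`: every walk `v, y, p, z, w` with
`v` not adjacent to `p`, `z` and `w` not adjacent to `y`, `p` is impossible. -/
theorem not_detour (hG : DistanceHereditary G) {v w x y p z : V}
    (hvx : G.Adj v x) (hxw : G.Adj x w) (hvw : ¬ G.Adj v w) (hne : v ≠ w)
    (hvy : G.Adj v y) (hyp : G.Adj y p) (hpz : G.Adj p z) (hzw : G.Adj z w)
    (hvz : ¬ G.Adj v z) (hwy : ¬ G.Adj y w) (hwp : ¬ G.Adj p w) : False := by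
  have h2 := dist_eq_two hvx hxw hvw hne
  obtain ⟨q, hq, hqd, hdist⟩ := hG.exists_adj_mem_support
    (Walk.cons hvy (Walk.cons hyp (Walk.cons hpz (Walk.cons hzw Walk.nil)))) hne
  have hq1 : G.Adj v q := dist_eq_one_iff_adj.1 (by omega)
  simp only [Walk.support_cons, Walk.support_nil, List.mem_cons, List.not_mem_nil, or_false] at hq
  rcases hq with rfl | rfl | rfl | rfl | rfl
  · exact hvw hqd
  · exact hwy hqd
  · exact hwp hqd
  · exact hvz hq1
  · exact hqd.ne rfl

theorem adj_of_not_adj_apex (hG : DistanceHereditary G) {v x y p z : V}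
    (hvx : G.Adj v x) (hvy : G.Adj v y) (hpy : G.Adj p y) (hpz : G.Adj p z) (hvp : ¬ G.Adj v p)
    (hzx : G.Adj z x) (hvz : ¬ G.Adj v z) (hne : v ≠ z) : G.Adj z y := by
  by_contra hzy
  have h2 := dist_eq_two hvx hzx.symm hvz hne
  obtain ⟨q, hq, hqd, hdist⟩ := hG.exists_adj_mem_support
    (Walk.cons hvy (Walk.cons hpy.symm (Walk.cons hpz Walk.nil))) hne
  have hq1 : G.Adj v q := dist_eq_one_iff_adj.1 (by omega)
  simp only [Walk.support_cons, Walk.support_nil, List.mem_cons, List.not_mem_nil, or_false] at hq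
  rcases hq with rfl | rfl | rfl | rfl
  · exact hvz hqd
  · exact hzy hqd.symm
  · exact hvp hq1
  · exact hqd.ne rfl

theorem exists_lower_adj (hc : G.Connected) {r x : V} (hx : r ≠ x) :
    ∃ p, G.Adj p x ∧ G.dist r p + 1 = G.dist r x := by
  obtain ⟨w, hw⟩ := hc.exists_walk_length_eq_dist x r
  cases w with
  | nil => exact absurd rfl hx
  | @cons _ q _ h w =>
    refine ⟨q, h.symm, ?_⟩
    have h1 := dist_le w
    have h2 := hc.dist_triangle (u := x) (v := q) (w := r)
    rw [dist_eq_one_iff_adj.2 h] at h2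
    rw [Walk.length_cons] at hw
    rw [SimpleGraph.dist_comm, SimpleGraph.dist_comm (u := r)]
    omega

/-- A connected distance-hereditary graph with at least two vertices has a pendant vertex or a
pair of twins. -/
theorem exists_pendant_or_areTwins [Finite V] [Nontrivial V] (hG : DistanceHereditary G)
    (hc : G.Connected) :
    (∃ u v, G.Adj v u ∧ ∀ w, G.Adj v w → w = u) ∨ ∃ u v, G.AreTwins u v := by
  classical
  have := Fintype.ofFinite V
  obtain ⟨r⟩ : Nonempty V := inferInstance
  obtain ⟨t, ht⟩ := Finite.exists_max (fun v => G.dist r v)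
  obtain ⟨k, hk⟩ : ∃ k, G.dist r t = k := ⟨_, rfl⟩
  have hmax : ∀ v, G.dist r v ≤ k := fun v => hk ▸ ht v
  have hkpos : 0 < k := by
    obtain ⟨s, hs⟩ := exists_ne r
    exact (hc.pos_dist_of_ne hs.symm).trans_le (hmax s)
  let low : V → Finset V := fun v => Finset.univ.filter (fun x => G.Adj v x ∧ G.dist r x + 1 = k)
  have mem_low : ∀ {v x}, x ∈ low v ↔ G.Adj v x ∧ G.dist r x + 1 = k := by simp [low]
  obtain ⟨v, hv, hvmin⟩ := Finset.exists_min_image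
    (Finset.univ.filter (fun v => G.dist r v = k)) (fun v => (low v).card) ⟨t, by simp [hk]⟩
  simp only [Finset.mem_filter, Finset.mem_univ, true_and] at hv hvmin
  have hrv : r ≠ v := by rintro rfl; simp at hv; omega
  obtain ⟨p, hpv, hp⟩ := exists_lower_adj hc hrv
  have hp_low : p ∈ low v := mem_low.2 ⟨hpv.symm, by omega⟩
  have low_congr : ∀ x y, G.dist r x = k → G.dist r y = k → G.Adj x y → low x ⊆ low y := by
    intro x y hx hy hxy q hq
    rw [mem_low] at hq ⊢
    exact ⟨(hG.adj_of_adj_same_level (r := r) hc hq.1.symm (by omega) hxy (by omega)).symm, hq.2⟩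
  have level : ∀ x y, G.Adj x y → G.dist r x ≤ G.dist r y + 1 := by
    intro x y hxy
    have := hc.dist_triangle (u := r) (v := y) (w := x)
    rwa [dist_eq_one_iff_adj.2 hxy.symm] at this
  let M : Finset V := Finset.univ.filter (fun w => G.dist r w = k ∧ low w = low v)
  have mem_M : ∀ {w}, w ∈ M ↔ G.dist r w = k ∧ low w = low v := by simp [M]
  have hvM : v ∈ M := mem_M.2 ⟨hv, rfl⟩
  by_cases hM : 2 ≤ M.card
  · right
    refine PathFourFreeOn.exists_areTwins M hM
      ((hG.pathFourFreeOn_neighborSet p).mono fun w hw => ?_) ?_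
    · have hw' := mem_M.1 hw
      rw [← hw'.2, mem_low] at hp_low
      exact hp_low.1.symm
    · intro x hx y hy z hz hzx
      have hx' := mem_M.1 hx
      have hy' := mem_M.1 hy
      by_cases hzk : G.dist r z = k
      · exact absurd (mem_M.2 ⟨hzk, ((low_congr z x hzk hx'.1 hzx).antisymm
          (low_congr x z hx'.1 hzk hzx.symm)).trans hx'.2⟩) hz
      · have h1 := hmax z
        have h2 := level x z hzx.symm
        have : z ∈ low x := mem_low.2 ⟨hzx.symm, by omega⟩
        rw [hx'.2, ← hy'.2, mem_low] at this
        exact this.1.symm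
  have hMv : ∀ w ∈ M, w = v := fun w hw =>
    Finset.card_le_one.1 (by omega) w hw v hvM
  have hnbr : ∀ x, G.Adj v x → x ∈ low v := by
    intro x hx
    rw [mem_low]
    refine ⟨hx, ?_⟩
    have h1 := hmax x
    have h2 := level v x hx
    by_contra hne
    have hxk : G.dist r x = k := by omega
    exact hx.ne (hMv x (mem_M.2 ⟨hxk, (low_congr x v hxk hv hx.symm).antisymm
      (low_congr v x hv hxk hx)⟩)).symm
  by_cases hD : 2 ≤ (low v).card
  · right
    refine PathFourFreeOn.exists_areTwins (low v) hD
      ((hG.pathFourFreeOn_neighborSet v).mono fun w hw => (mem_low.1 hw).1) ?_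
    intro x hx y hy z hz hzx
    have hx' := mem_low.1 hx
    have hy' := mem_low.1 hy
    by_cases hzv : z = v
    · exact hzv ▸ hy'.1
    by_cases hxy : x = y
    · exact hxy ▸ hzx
    have hrx : r ≠ x := by
      rintro rfl
      have h1 := hx'.2
      rw [SimpleGraph.dist_self] at h1
      exact hxy ((hc.dist_eq_zero_iff).1 (by omega))
    obtain ⟨q, hqx, hq⟩ := exists_lower_adj (r := r) hc hrx
    have hlow : ∀ w s, G.Adj w x → G.Adj w s → G.dist r w = k → G.dist r s + 1 = k →
        G.Adj q s := fun w s hwx hws hw hs =>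
      hG.adj_of_common_upper (r := r) hc hqx hq hwx.symm hws (by omega) (by omega)
    have hqy : G.Adj q y := hlow v y hx'.1 hy'.1 hv hy'.2
    have hvz : ¬ G.Adj v z := fun h => hz (hnbr z h)
    have far : ∀ w, G.dist r w = k → ¬ G.Adj w q := fun w hw h => by
      have := level w q h
      omega
    have h1 := level x z hzx.symm
    rcases (show G.dist r z = k ∨ G.dist r z + 1 = k ∨ G.dist r z + 2 = k by
      have := hmax z; omega) with hzk | hzk | hzk
    · by_contra hzy
      have hsub : ¬ low z ⊆ low v := fun hs => by
        have heq := Finset.eq_of_subset_of_card_le hs (hvmin z hzk)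
        exact hzv (hMv z (mem_M.2 ⟨hzk, heq⟩))
      obtain ⟨s, hs, hsv⟩ := Finset.not_subset.1 hsub
      have hs' := mem_low.1 hs
      exact hG.not_detour hx'.1 hzx.symm hvz (Ne.symm hzv) hy'.1 hqy.symm
        (hlow z s hzx hs'.1 hzk hs'.2) hs'.1.symm (fun h => hsv (hnbr s h))
        (fun h => hzy h.symm) (fun h => far z hzk h.symm)
    · exact hG.adj_of_not_adj_apex hx'.1 hy'.1 hqy
        (hG.adj_of_adj_same_level (r := r) hc hqx hq hzx.symm (by omega)) (far v hv) hzx hvz (Ne.symm hzv)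
    · exact hG.adj_of_common_upper (r := r) hc hzx (by omega) hx'.1.symm hy'.1 (by omega) (by omega)
  · left
    refine ⟨p, v, hpv.symm, fun w hw => ?_⟩
    exact Finset.card_le_one.1 (by omega) w (hnbr w hw) p hp_low

end DistanceHereditary

end Pruning

section Construction

/-- A finite simple graph together with a set of marked vertices, those through which it may be
joined to further vertices. -/
structure MarkedGraph : Type 1 where
  V : Type
  finite : Finite V
  G : SimpleGraph V
  S : Set V

namespace MarkedGraph

/-- Isomorphism of marked graphs. -/
def Iso (a b : MarkedGraph) : Prop :=
  ∃ e : a.V ≃ b.V, (∀ x y, b.G.Adj (e x) (e y) ↔ a.G.Adj x y) ∧ ∀ x, e x ∈ b.S ↔ x ∈ a.S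

instance setoid : Setoid MarkedGraph where
  r := Iso
  iseqv := by
    refine ⟨fun a => ⟨Equiv.refl _, by simp⟩, ?_, ?_⟩
    · rintro a b ⟨e, h1, h2⟩
      exact ⟨e.symm, fun x y => by simp [← h1], fun x => by simp [← h2]⟩
    · rintro a b c ⟨e, h1, h2⟩ ⟨f, h3, h4⟩
      exact ⟨e.trans f, fun x y => by simp [h1, h3], fun x => by simp [h2, h4]⟩

theorem mk_equiv_mk {V W : Type} {hV : Finite V} {hW : Finite W} {G : SimpleGraph V} {S : Set V}
    {H : SimpleGraph W} {T : Set W} (e : V ≃ W) (h1 : ∀ x y, H.Adj (e x) (e y) ↔ G.Adj x y)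
    (h2 : ∀ x, e x ∈ T ↔ x ∈ S) : (⟨V, hV, G, S⟩ : MarkedGraph) ≈ ⟨W, hW, H, T⟩ :=
  ⟨e, h1, h2⟩

section Operations

variable {V W : Type}

/-- The disjoint union of two graphs, in which `S` and `T` are joined completely if `j` is
true. -/
def combGraph (j : Bool) (G : SimpleGraph V) (S : Set V) (H : SimpleGraph W) (T : Set W) :
    SimpleGraph (V ⊕ W) where
  Adj x y :=
    match x, y with
    | .inl x, .inl y => G.Adj x y
    | .inr x, .inr y => H.Adj x y
    | .inl x, .inr y => j ∧ x ∈ S ∧ y ∈ T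
    | .inr x, .inl y => j ∧ y ∈ S ∧ x ∈ T
  symm := ⟨by
    rintro (x | x) (y | y) h
    · exact G.adj_symm h
    · exact h
    · exact h
    · exact H.adj_symm h⟩
  loopless := ⟨by
    rintro (x | x) h
    · exact G.loopless.irrefl _ h
    · exact H.loopless.irrefl _ h⟩

/-- The marks of the first part, together with those of the second part if `k` is true. -/
def combSet (k : Bool) (S : Set V) (T : Set W) : Set (V ⊕ W) :=
  {x | Sum.elim (fun x => x ∈ S) (fun y => k ∧ y ∈ T) x}

/-- Adding a new vertex `none`, adjacent to `u` if `j` is true and having the same other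
neighbours as `u` if `k` is true, no other neighbours otherwise. -/
def extendGraph (j k : Bool) (G : SimpleGraph V) (u : V) : SimpleGraph (Option V) where
  Adj x y :=
    match x, y with
    | some x, some y => G.Adj x y
    | none, some y => (y = u ∧ j) ∨ (y ≠ u ∧ k ∧ G.Adj u y)
    | some x, none => (x = u ∧ j) ∨ (x ≠ u ∧ k ∧ G.Adj u x)
    | none, none => False
  symm := ⟨by
    rintro (_ | x) (_ | y) h
    · exact h
    · exact h
    · exact h
    · exact G.adj_symm h⟩
  loopless := ⟨by
    rintro (_ | x) h
    · exact h
    · exact G.loopless.irrefl _ h⟩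

/-- The new vertex `none` is marked if `k` is true and `u` is marked. -/
def extendSet (k : Bool) (S : Set V) (u : V) : Set (Option V) :=
  {x | x.elim (k ∧ u ∈ S) (fun x => x ∈ S)}

variable {j k : Bool} {G : SimpleGraph V} {H : SimpleGraph W} {S : Set V} {T : Set W}

@[simp] theorem combGraph_inl_inl {x y : V} :
    (combGraph j G S H T).Adj (.inl x) (.inl y) ↔ G.Adj x y := Iff.rfl

@[simp] theorem combGraph_inr_inr {x y : W} :
    (combGraph j G S H T).Adj (.inr x) (.inr y) ↔ H.Adj x y := Iff.rfl

@[simp] theorem combGraph_inl_inr {x : V} {y : W} :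
    (combGraph j G S H T).Adj (.inl x) (.inr y) ↔ j ∧ x ∈ S ∧ y ∈ T := Iff.rfl

@[simp] theorem combGraph_inr_inl {x : W} {y : V} :
    (combGraph j G S H T).Adj (.inr x) (.inl y) ↔ j ∧ y ∈ S ∧ x ∈ T := Iff.rfl

@[simp] theorem inl_mem_combSet {x : V} : .inl x ∈ combSet k S T ↔ x ∈ S := Iff.rfl

@[simp] theorem inr_mem_combSet {y : W} : .inr y ∈ combSet k S T ↔ k ∧ y ∈ T := Iff.rfl

@[simp] theorem extendGraph_some_some {u x y : V} :
    (extendGraph j k G u).Adj (some x) (some y) ↔ G.Adj x y := Iff.rfl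

@[simp] theorem extendGraph_none_some {u y : V} :
    (extendGraph j k G u).Adj none (some y) ↔ (y = u ∧ j) ∨ (y ≠ u ∧ k ∧ G.Adj u y) := Iff.rfl

@[simp] theorem extendGraph_some_none {u x : V} :
    (extendGraph j k G u).Adj (some x) none ↔ (x = u ∧ j) ∨ (x ≠ u ∧ k ∧ G.Adj u x) := Iff.rfl

@[simp] theorem none_mem_extendSet {u : V} : none ∈ extendSet k S u ↔ k ∧ u ∈ S := Iff.rfl

@[simp] theorem some_mem_extendSet {u x : V} : some x ∈ extendSet k S u ↔ x ∈ S := Iff.rfl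

end Operations

/-- The disjoint union of two marked graphs. The marked vertices of the two parts are joined
completely if `j` is true, and the second part keeps its marks if `k` is true. -/
def comb (j k : Bool) (a b : MarkedGraph) : MarkedGraph where
  V := a.V ⊕ b.V
  finite := by
    have := a.finite
    have := b.finite
    infer_instance
  G := combGraph j a.G a.S b.G b.S
  S := combSet k a.S b.S

/-- Adding a pendant vertex or a twin to `u`. -/
def extend (j k : Bool) (a : MarkedGraph) (u : a.V) : MarkedGraph where
  V := Option a.V
  finite := by
    have := a.finite
    infer_instance
  G := extendGraph j k a.G u
  S := extendSet k a.S u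

/-- The marked graph without vertices. -/
def empty : MarkedGraph := ⟨Empty, inferInstance, ⊥, ∅⟩

/-- The graph with a single, marked vertex. -/
def point : MarkedGraph := ⟨Unit, inferInstance, ⊥, Set.univ⟩

theorem comb_congr {j k : Bool} {a a' b b' : MarkedGraph} (ha : a ≈ a') (hb : b ≈ b') :
    comb j k a b ≈ comb j k a' b' := by
  obtain ⟨e, h1, h2⟩ := ha
  obtain ⟨f, h3, h4⟩ := hb
  dsimp only [comb]
  refine mk_equiv_mk (Equiv.sumCongr e f) ?_ ?_
  · rintro (x | x) (y | y) <;> simp [h1, h2, h3, h4]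
  · rintro (x | x) <;> simp [h2, h4]

theorem comb_assoc (j : Bool) (a b c : MarkedGraph) :
    comb j true (comb j true a b) c ≈ comb j true a (comb j true b c) := by
  dsimp only [comb]
  refine mk_equiv_mk (Equiv.sumAssoc _ _ _) ?_ ?_
  · rintro ((x | x) | x) ((y | y) | y) <;> simp
  · rintro ((x | x) | x) <;> simp

theorem comb_comm (j : Bool) (a b : MarkedGraph) : comb j true a b ≈ comb j true b a := by
  dsimp only [comb]
  refine mk_equiv_mk (Equiv.sumComm _ _) ?_ ?_
  · rintro (x | x) (y | y) <;> simp <;> tauto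
  · rintro (x | x) <;> simp

theorem comb_empty (j : Bool) (a : MarkedGraph) : comb j true a empty ≈ a := by
  dsimp only [comb, empty]
  refine mk_equiv_mk (W := a.V) (Equiv.sumEmpty a.V Empty) ?_ ?_
  · rintro (x | ⟨⟨⟩⟩) (y | ⟨⟨⟩⟩)
    simp
  · rintro (x | ⟨⟨⟩⟩)
    simp

theorem comb_pendant_assoc (a b c : MarkedGraph) :
    comb true false (comb true false a b) c ≈ comb true false a (comb false true b c) := by
  dsimp only [comb]
  refine mk_equiv_mk (Equiv.sumAssoc _ _ _) ?_ ?_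
  · rintro ((x | x) | x) ((y | y) | y) <;> simp
  · rintro ((x | x) | x) <;> simp

theorem extend_congr {j k : Bool} {a b : MarkedGraph} (e : a.V ≃ b.V)
    (h1 : ∀ x y, b.G.Adj (e x) (e y) ↔ a.G.Adj x y) (h2 : ∀ x, e x ∈ b.S ↔ x ∈ a.S) (u : a.V) :
    extend j k a u ≈ extend j k b (e u) := by
  dsimp only [extend]
  refine mk_equiv_mk e.optionCongr ?_ ?_
  · rintro (_ | x) (_ | y) <;> simp [h1]
  · rintro (_ | x) <;> simp [h2]

theorem extend_point (j k : Bool) (u : point.V) : extend j k point u ≈ comb j k point point := by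
  let e : Option Unit ≃ Unit ⊕ Unit :=
    { toFun := fun x => x.elim (.inr ()) .inl
      invFun := Sum.elim some fun _ => none
      left_inv := by rintro (_ | x) <;> rfl
      right_inv := by rintro (x | x) <;> rfl }
  obtain ⟨⟩ : Unit := u
  dsimp only [comb, extend, point]
  refine mk_equiv_mk e ?_ ?_
  · rintro (_ | ⟨⟩) (_ | ⟨⟩) <;> simp [e]
  · rintro (_ | ⟨⟩) <;> simp [e]

theorem extend_comb_inl (j k j' k' : Bool) (a b : MarkedGraph) (u : a.V) :
    extend j k (comb j' k' a b) (.inl u) ≈ comb j' k' (extend j k a u) b := by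
  let e : Option (a.V ⊕ b.V) ≃ Option a.V ⊕ b.V :=
    { toFun := fun x => x.elim (.inl none) (Sum.elim (fun x => .inl (some x)) .inr)
      invFun := Sum.elim (Option.map .inl) (fun y => some (.inr y))
      left_inv := by rintro (_ | x | x) <;> rfl
      right_inv := by rintro ((_ | x) | x) <;> rfl }
  dsimp only [comb, extend]
  refine mk_equiv_mk e ?_ ?_
  · rintro (_ | x | x) (_ | y | y) <;> simp [e] <;> tauto
  · rintro (_ | x | x) <;> simp [e]

theorem extend_comb_inr (j k j' k' : Bool) (a b : MarkedGraph) (u : b.V) :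
    extend j k (comb j' k' a b) (.inr u) ≈ comb j' k' a (extend j k b u) := by
  let e : Option (a.V ⊕ b.V) ≃ a.V ⊕ Option b.V :=
    { toFun := fun x => x.elim (.inr none) (Sum.elim .inl (fun x => .inr (some x)))
      invFun := Sum.elim (fun y => some (.inl y)) (Option.map .inr)
      left_inv := by rintro (_ | x | x) <;> rfl
      right_inv := by rintro (x | _ | x) <;> rfl }
  dsimp only [comb, extend]
  refine mk_equiv_mk e ?_ ?_
  · rintro (_ | x | x) (_ | y | y) <;> simp [e] <;> tauto
  · rintro (_ | x | x) <;> simp [e]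
    tauto

end MarkedGraph

/-- Isomorphism classes of marked graphs. -/
abbrev MarkedClass : Type 1 := Quotient MarkedGraph.setoid

namespace MarkedClass

open MarkedGraph

/-- The operation `MarkedGraph.comb` on isomorphism classes. -/
def comb (j k : Bool) : MarkedClass → MarkedClass → MarkedClass :=
  Quotient.map₂ (MarkedGraph.comb j k) fun _ _ ha _ _ hb => comb_congr ha hb

/-- The number of vertices. -/
noncomputable def size : MarkedClass → ℕ :=
  Quotient.lift (fun a => Nat.card a.V) fun _ _ ⟨e, _⟩ => Nat.card_congr e

theorem size_comb (j k : Bool) (x y : MarkedClass) : size (comb j k x y) = size x + size y := by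
  induction x using Quotient.inductionOn with | _ a
  induction y using Quotient.inductionOn with | _ b
  have := a.finite
  have := b.finite
  exact Nat.card_sum

theorem comb_comm (j : Bool) (x y : MarkedClass) : comb j true x y = comb j true y x := by
  induction x using Quotient.inductionOn with | _ a
  induction y using Quotient.inductionOn with | _ b
  exact Quotient.sound (MarkedGraph.comb_comm j a b)

theorem comb_empty (j : Bool) (x : MarkedClass) : comb j true x ⟦empty⟧ = x := by
  induction x using Quotient.inductionOn with | _ a
  exact Quotient.sound (MarkedGraph.comb_empty j a)

theorem comb_assoc (j : Bool) (x y z : MarkedClass) :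
    comb j true (comb j true x y) z = comb j true x (comb j true y z) := by
  induction x using Quotient.inductionOn with | _ a
  induction y using Quotient.inductionOn with | _ b
  induction z using Quotient.inductionOn with | _ c
  exact Quotient.sound (MarkedGraph.comb_assoc j a b c)

theorem comb_pendant_assoc (x y z : MarkedClass) :
    comb true false (comb true false x y) z = comb true false x (comb false true y z) := by
  induction x using Quotient.inductionOn with | _ a
  induction y using Quotient.inductionOn with | _ b
  induction z using Quotient.inductionOn with | _ c
  exact Quotient.sound (MarkedGraph.comb_pendant_assoc a b c)

instance (j : Bool) : LeftCommutative (comb j true) :=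
  ⟨fun x y z => by rw [← comb_assoc, comb_comm j x y, comb_assoc]⟩

/-- The combination of a multiset of classes, all marks being kept. -/
def combAll (j : Bool) (s : Multiset MarkedClass) : MarkedClass :=
  s.foldr (comb j true) ⟦empty⟧

theorem combAll_add (j : Bool) (s t : Multiset MarkedClass) :
    combAll j (s + t) = comb j true (combAll j s) (combAll j t) := by
  induction s using Multiset.induction_on with
  | empty => rw [zero_add, comb_comm]; exact (comb_empty j _).symm
  | cons a s ih =>
    rw [Multiset.cons_add, combAll, Multiset.foldr_cons, ← combAll, ih, ← comb_assoc]
    simp [combAll]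

theorem combAll_singleton (j : Bool) (x : MarkedClass) : combAll j {x} = x :=
  (Multiset.foldr_singleton _ _ _).trans (comb_empty j x)

theorem size_combAll (j : Bool) (s : Multiset MarkedClass) :
    size (combAll j s) = (s.map size).sum := by
  induction s using Multiset.induction_on with
  | empty => exact Nat.card_of_isEmpty (α := Empty)
  | cons a s ih =>
    rw [combAll, Multiset.foldr_cons, size_comb, ← combAll, ih, Multiset.map_cons,
      Multiset.sum_cons]

/-- The classes built from single vertices by the combinations that correspond to the addition
of pendant vertices, true twins and false twins. -/
inductive Constructible : MarkedClass → Prop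
  | point : Constructible ⟦point⟧
  | comb (j k : Bool) (h : j || k) {x y : MarkedClass} (hx : Constructible x)
      (hy : Constructible y) : Constructible (comb j k x y)

theorem size_point : size ⟦point⟧ = 1 := Nat.card_unique (α := Unit)

theorem Constructible.size_pos {x : MarkedClass} (hx : Constructible x) : 0 < size x := by
  induction hx with
  | point => rw [size_point]; exact one_pos
  | comb j k h _ _ ih1 ih2 => rw [size_comb]; omega

theorem Constructible.extend {j k : Bool} (h : j || k) {x : MarkedClass} (hx : Constructible x)
    (a : MarkedGraph) (ha : ⟦a⟧ = x) (u : a.V) : Constructible ⟦a.extend j k u⟧ := by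
  induction hx generalizing a with
  | point =>
    obtain ⟨e, h1, h2⟩ := Quotient.exact ha
    rw [Quotient.sound (extend_congr e h1 h2 u), Quotient.sound (extend_point j k (e u))]
    exact .comb j k h .point .point
  | @comb j' k' h' x y hx hy ih1 ih2 =>
    induction x using Quotient.inductionOn with | _ b
    induction y using Quotient.inductionOn with | _ c
    obtain ⟨e, h1, h2⟩ := Quotient.exact (ha : ⟦a⟧ = ⟦b.comb j' k' c⟧)
    rw [Quotient.sound (extend_congr e h1 h2 u)]
    rcases e u with v | v
    · rw [Quotient.sound (extend_comb_inl j k j' k' b c v)]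
      exact .comb j' k' h' (ih1 b rfl v) hy
    · rw [Quotient.sound (extend_comb_inr j k j' k' b c v)]
      exact .comb j' k' h' hx (ih2 c rfl v)

end MarkedClass

open MarkedClass

/-- If a vertex `v` can be removed as a pendant vertex or as a twin of `u`, a construction of the
smaller graph extends to one of the whole graph. -/
theorem MarkedClass.Constructible.of_remove {V : Type} [Finite V] {G : SimpleGraph V} {u v : V}
    (huv : u ≠ v) {j k : Bool} (h : j || k) (hj : G.Adj v u ↔ j)
    (hk : ∀ w, w ≠ u → w ≠ v → (G.Adj v w ↔ k ∧ G.Adj u w)) {S : Set {w // w ≠ v}}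
    (hc : Constructible ⟦⟨{w // w ≠ v}, inferInstance, G.comap (↑), S⟩⟧) :
    ∃ S : Set V, Constructible ⟦⟨V, inferInstance, G, S⟩⟧ := by
  classical
  have hc' := hc.extend h _ rfl ⟨u, huv⟩
  let e : Option {w // w ≠ v} ≃ V := Equiv.optionSubtypeNe v
  refine ⟨{w | e.symm w ∈ MarkedGraph.extendSet k S ⟨u, huv⟩}, ?_⟩
  convert hc' using 1
  refine (Quotient.sound (MarkedGraph.mk_equiv_mk e ?_ fun x => ?_)).symm
  · have key : ∀ w : {w // w ≠ v}, G.Adj v w ↔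
        (w = ⟨u, huv⟩ ∧ j) ∨ (w ≠ ⟨u, huv⟩ ∧ k ∧ G.Adj u w) := by
      rintro ⟨w, hw⟩
      by_cases hwu : w = u
      · subst hwu
        simpa using hj
      · simpa [hwu] using hk w hwu hw
    rintro (_ | x) (_ | y)
    · simp [e]
    · simpa [e] using key y
    · simpa [e, G.adj_comm _ v] using key x
    · simp [e]
  · simp

end Construction

section Representation

open SimpleGraph MarkedClass

/-- Removing from a connected graph a vertex `v` whose neighbours other than `u` are neighbours of
`u` leaves a connected graph. -/
theorem SimpleGraph.Connected.comap_ne {V : Type} {G : SimpleGraph V} (hc : G.Connected) {u v : V}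
    (huv : u ≠ v) (h : ∀ w, w ≠ u → G.Adj v w → G.Adj u w) :
    (G.comap ((↑) : {w // w ≠ v} → V)).Connected := by
  classical
  let f : V → {w // w ≠ v} := fun w => if hw : w = v then ⟨u, huv⟩ else ⟨w, hw⟩
  have hf : ∀ x y, G.Adj x y → (G.comap ((↑) : {w // w ≠ v} → V)).Reachable (f x) (f y) := by
    intro x y hxy
    by_cases hfe : f x = f y
    · rw [hfe]
    refine Adj.reachable ?_
    rw [comap_adj]
    by_cases hx : x = v <;> by_cases hy : y = v
    · exact absurd (by rw [hx, hy]) hfe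
    · simp only [f, hx, hy, dite_true, dite_false] at hfe ⊢
      exact h y (fun e => hfe (Subtype.ext e.symm)) (hx ▸ hxy)
    · simp only [f, hx, hy, dite_true, dite_false] at hfe ⊢
      exact (h x (fun e => hfe (Subtype.ext e)) (hy ▸ hxy.symm)).symm
    · simpa only [f, hx, hy, dite_false] using hxy
  have hw : ∀ x y, G.Walk x y → (G.comap ((↑) : {w // w ≠ v} → V)).Reachable (f x) (f y) := by
    intro x y w
    induction w with
    | nil => exact Reachable.refl _
    | cons hxy _ ih => exact (hf _ _ hxy).trans ih
  have : Nonempty {w // w ≠ v} := ⟨⟨u, huv⟩⟩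
  refine ⟨fun x y => ?_⟩
  obtain ⟨w⟩ := hc.preconnected x y
  simpa [f, x.2, y.2] using hw _ _ w

theorem DistanceHereditary.comap_subtype {V : Type} {G : SimpleGraph V} {p : V → Prop}
    (hG : DistanceHereditary G) (hc : (G.comap ((↑) : {w // p w} → V)).Connected) :
    DistanceHereditary (G.comap ((↑) : {w // p w} → V)) := by
  intro S hS x y
  let T : Set V := (↑) '' S
  let e : (G.comap ((↑) : {w // p w} → V)).induce S ≃g G.induce T :=
    { Equiv.Set.image _ S Subtype.val_injective with
      map_rel_iff' := by intro a b; rfl }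
  have hT : (G.induce T).Connected := (Iso.connected_iff e).1 hS
  have h1 := hG T hT (e x) (e y)
  have h2 := hG {w | p w} hc x.1 y.1
  have h3 : (G.induce T).dist (e x) (e y) = (induce S (G.comap (↑))).dist x y := by
    refine le_antisymm ?_ ?_
    · obtain ⟨w, hw⟩ := hS.exists_walk_length_eq_dist x y
      rw [← hw]
      exact (dist_le (w.map e.toHom)).trans_eq (Walk.length_map _ _)
    · obtain ⟨w, hw⟩ := hT.exists_walk_length_eq_dist (e x) (e y)
      rw [← hw]
      have := dist_le ((w.map e.symm.toHom).copy (e.symm_apply_apply x) (e.symm_apply_apply y))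
      rwa [Walk.length_copy, Walk.length_map] at this
  exact h3.symm.trans (h1.trans h2.symm)

/-- Every connected distance-hereditary graph is constructible with a suitable set of marks. -/
theorem DistanceHereditary.exists_constructible {V : Type} [Finite V] {G : SimpleGraph V}
    (hG : DistanceHereditary G) (hc : G.Connected) :
    ∃ S : Set V, Constructible ⟦⟨V, inferInstance, G, S⟩⟧ := by
  induction hn : Nat.card V using Nat.strong_induction_on generalizing V with
  | _ n ih =>
  subst hn
  have := hc.nonempty
  rcases subsingleton_or_nontrivial V with hV | hV
  · obtain ⟨r⟩ := hc.nonempty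
    refine ⟨Set.univ, ?_⟩
    have : (⟦⟨V, inferInstance, G, Set.univ⟩⟧ : MarkedClass) = ⟦MarkedGraph.point⟧ := by
      refine Quotient.sound (MarkedGraph.mk_equiv_mk ⟨fun _ => (), fun _ => r,
        fun _ => Subsingleton.elim _ _, fun _ => rfl⟩ (fun x y => ?_) (fun x => by simp))
      simp [Subsingleton.elim x y]
    exact this ▸ .point
  have remove : ∀ u v : V, u ≠ v → ∀ j k : Bool, (j || k) → (G.Adj v u ↔ j) →
      (∀ w, w ≠ u → w ≠ v → (G.Adj v w ↔ k ∧ G.Adj u w)) →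
      ∃ S : Set V, Constructible ⟦⟨V, inferInstance, G, S⟩⟧ := by
    intro u v huv j k h hj hk
    have hc' : (G.comap ((↑) : {w // w ≠ v} → V)).Connected :=
      hc.comap_ne huv fun w hwu hvw => ((hk w hwu hvw.ne').1 hvw).2
    obtain ⟨S, hS⟩ := ih (Nat.card {w // w ≠ v})
      (Finite.card_subtype_lt (x := v) (by simp)) (hG.comap_subtype hc') hc' rfl
    exact hS.of_remove huv h hj hk
  rcases hG.exists_pendant_or_areTwins hc with ⟨u, v, hvu, h⟩ | ⟨u, v, huv, h⟩
  · exact remove u v hvu.ne' true false rfl (by simpa) fun w hwu _ => by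
      simpa using fun hvw => hwu (h w hvw)
  · by_cases hvu : G.Adj v u
    · exact remove u v huv true true rfl (by simpa) fun w hwu hwv => by
        simpa [G.adj_comm] using (h w hwu hwv).symm
    · exact remove u v huv false true rfl (by simpa) fun w hwu hwv => by
        simpa [G.adj_comm] using (h w hwu hwv).symm

end Representation

section Counting

/-- The total weight of finitely many multisets over `B` is at most that of all of them. -/
theorem Finset.sum_prod_multiset_le {α : Type*} (B : Finset α) (w : α → ℝ)
    (h0 : ∀ b ∈ B, 0 ≤ w b) (h1 : ∀ b ∈ B, w b < 1) (T : Finset (Multiset α))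
    (hT : ∀ s ∈ T, ∀ b ∈ s, b ∈ B) :
    ∑ s ∈ T, (s.map w).prod ≤ ∏ b ∈ B, (1 - w b)⁻¹ := by
  classical
  obtain ⟨K, hK⟩ : ∃ K, ∀ s ∈ T, s.card < K :=
    ⟨T.sup Multiset.card + 1, fun s hs => Nat.lt_succ_of_le (Finset.le_sup hs)⟩
  obtain ⟨φ, hφ⟩ : ∃ φ : Multiset α → ∀ b ∈ B, ℕ, ∀ s b hb, φ s b hb = s.count b :=
    ⟨fun s b _ => s.count b, fun _ _ _ => rfl⟩
  have hinj : Set.InjOn φ T := by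
    intro s hs t ht hst
    ext b
    by_cases hb : b ∈ B
    · rw [← hφ s b hb, hst, hφ]
    · rw [Multiset.count_eq_zero_of_notMem fun h => hb (hT s hs b h),
        Multiset.count_eq_zero_of_notMem fun h => hb (hT t ht b h)]
  have hval : ∀ s ∈ T, (s.map w).prod = ∏ b ∈ B.attach, w b ^ φ s b b.2 := by
    intro s hs
    simp only [hφ]
    rw [Finset.prod_multiset_map_count, Finset.prod_attach B fun b => w b ^ s.count b]
    refine Finset.prod_subset (fun b hb => hT s hs b (by simpa using hb)) fun b _ hb => ?_
    rw [Multiset.count_eq_zero_of_notMem (by simpa using hb), pow_zero]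
  have hsub : T.image φ ⊆ B.pi fun _ => Finset.range K := by
    intro p hp
    obtain ⟨s, hs, rfl⟩ := Finset.mem_image.1 hp
    rw [Finset.mem_pi]
    intro b hb
    rw [hφ]
    exact Finset.mem_range.2 ((Multiset.count_le_card b s).trans_lt (hK s hs))
  rw [Finset.sum_congr rfl hval,
    ← Finset.sum_image (f := fun p : ∀ b ∈ B, ℕ => ∏ b ∈ B.attach, w b ^ p b.1 b.2) hinj]
  refine (Finset.sum_le_sum_of_subset_of_nonneg hsub fun p _ _ =>
    Finset.prod_nonneg fun (b : B) _ => pow_nonneg (h0 b b.2) _).trans ?_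
  rw [← Finset.prod_sum B (fun _ => Finset.range K) fun b i => w b ^ i]
  refine Finset.prod_le_prod (fun b hb => Finset.sum_nonneg fun i _ =>
    pow_nonneg (h0 b hb) i) fun b hb => ?_
  rw [← tsum_geometric_of_lt_one (h0 b hb) (h1 b hb)]
  exact (summable_geometric_of_lt_one (h0 b hb) (h1 b hb)).sum_le_tsum _
    fun i _ => pow_nonneg (h0 b hb) i

theorem prod_inv_one_sub_le_exp {α : Type*} (R : Finset α) (w : α → ℝ)
    (h0 : ∀ b ∈ R, 0 ≤ w b) (h1 : ∀ b ∈ R, w b ≤ 1 / 64) :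
    ∏ b ∈ R, (1 - w b)⁻¹ ≤ Real.exp (64 / 63 * ∑ b ∈ R, w b) := by
  rw [Finset.mul_sum, Real.exp_sum]
  refine Finset.prod_le_prod (fun b hb => inv_nonneg.2 (by linarith [h1 b hb])) fun b hb => ?_
  have h2 := h0 b hb
  have h3 := h1 b hb
  refine le_trans ?_ (Real.add_one_le_exp _)
  rw [inv_le_iff_one_le_mul₀ (by linarith)]
  nlinarith

theorem exp_bound_of_le {β : ℝ} (h0 : 0 ≤ β) (h1 : β ≤ 7 / 48) :
    8 / 7 * Real.exp (64 / 63 * β) ≤ 1 + (1 / 8 + β) + 1 / 16 := by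
  obtain ⟨u, rfl⟩ : ∃ u, β = 63 / 32 * u := ⟨32 / 63 * β, by ring⟩
  have hu0 : 0 ≤ u := by linarith
  have hu1 : u ≤ 2 / 27 := by linarith
  have hexp : Real.exp u ≤ 1 + u + u ^ 2 := by
    have := (abs_le.1 (Real.abs_exp_sub_one_sub_id_le (x := u) (abs_le.2 ⟨by linarith,
      by linarith⟩))).2
    linarith
  have hsq : Real.exp (64 / 63 * (63 / 32 * u)) ≤ (1 + u + u ^ 2) ^ 2 := by
    rw [show 64 / 63 * (63 / 32 * u) = u + u by ring, Real.exp_add, ← sq]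
    exact pow_le_pow_left₀ (Real.exp_pos u).le hexp 2
  have h2 : u ^ 2 ≤ 2 / 27 * u := by nlinarith
  have h3 : u ^ 3 ≤ 2 / 27 * (2 / 27 * u) := by nlinarith
  have h4 : u ^ 4 ≤ 2 / 27 * (2 / 27 * (2 / 27 * u)) := by nlinarith [pow_nonneg hu0 3]
  nlinarith

namespace MarkedClass

/-- The weight of a class in the generating function evaluated at `1 / 8`. -/
noncomputable def weight (x : MarkedClass) : ℝ := (1 / 8) ^ size x

theorem weight_pos (x : MarkedClass) : 0 < weight x := by
  unfold weight
  positivity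

theorem weight_le_of_le_size {x : MarkedClass} {n : ℕ} (h : n ≤ size x) :
    weight x ≤ (1 / 8) ^ n :=
  pow_le_pow_of_le_one (by norm_num) (by norm_num) h

theorem weight_point : weight ⟦MarkedGraph.point⟧ = 1 / 8 := by
  rw [weight, size_point, pow_one]

theorem weight_comb (j k : Bool) (x y : MarkedClass) :
    weight (comb j k x y) = weight x * weight y := by
  rw [weight, size_comb, pow_add, weight, weight]

theorem weight_combAll (j : Bool) (s : Multiset MarkedClass) :
    weight (combAll j s) = (s.map weight).prod := by
  rw [weight, size_combAll]
  induction s using Multiset.induction_on with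
  | empty => simp
  | cons a s ih => rw [Multiset.map_cons, Multiset.sum_cons, pow_add, ih, Multiset.map_cons,
      Multiset.prod_cons, weight]

/-- The members of `P` with at most `N` vertices have total weight at most `c`. -/
def WeightBound (P : MarkedClass → Prop) (N : ℕ) (c : ℝ) : Prop :=
  ∀ T : Finset MarkedClass, (∀ x ∈ T, P x ∧ size x ≤ N) → ∑ x ∈ T, weight x ≤ c

theorem WeightBound.or {P Q : MarkedClass → Prop} {N : ℕ} {c d : ℝ} (hP : WeightBound P N c)
    (hQ : WeightBound Q N d) : WeightBound (fun x => P x ∨ Q x) N (c + d) := by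
  classical
  intro T hT
  rw [← Finset.sum_filter_add_sum_filter_not T P]
  refine add_le_add (hP _ fun x hx => ?_) (hQ _ fun x hx => ?_)
  · rw [Finset.mem_filter] at hx
    exact ⟨hx.2, (hT x hx.1).2⟩
  · rw [Finset.mem_filter] at hx
    exact ⟨(hT x hx.1).1.resolve_left hx.2, (hT x hx.1).2⟩

theorem weightBound_point (N : ℕ) : WeightBound (· = ⟦MarkedGraph.point⟧) N (1 / 8) := by
  intro T hT
  have hsub : T ⊆ {⟦MarkedGraph.point⟧} := fun x hx => Finset.mem_singleton.2 (hT x hx).1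
  refine (Finset.sum_le_sum_of_subset_of_nonneg hsub fun x _ _ => (weight_pos x).le).trans ?_
  rw [Finset.sum_singleton, weight_point]

theorem weightBound_comb {P Q : MarkedClass → Prop} {N : ℕ} {c d : ℝ} (j k : Bool)
    (hP : WeightBound P N c) (hQ : WeightBound Q N d) (hP0 : ∀ x, P x → 0 < size x)
    (hQ0 : ∀ x, Q x → 0 < size x) :
    WeightBound (fun x => ∃ a b, P a ∧ Q b ∧ x = comb j k a b) (N + 1) (c * d) := by
  classical
  intro T hT
  have : Nonempty MarkedClass := ⟨⟦MarkedGraph.point⟧⟩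
  choose! a b hab using fun x hx => (hT x hx).1
  have hinj : Set.InjOn (fun x => (a x, b x)) T := by
    intro x hx y hy hxy
    rw [Prod.mk.injEq] at hxy
    rw [(hab x hx).2.2, (hab y hy).2.2, hxy.1, hxy.2]
  have hsize : ∀ x ∈ T, size (a x) ≤ N ∧ size (b x) ≤ N := by
    intro x hx
    have h1 := hP0 _ (hab x hx).1
    have h2 := hQ0 _ (hab x hx).2.1
    have h3 := (hT x hx).2
    rw [(hab x hx).2.2, size_comb] at h3
    omega
  have hA := hP (T.image a) fun y hy => by
    obtain ⟨x, hx, rfl⟩ := Finset.mem_image.1 hy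
    exact ⟨(hab x hx).1, (hsize x hx).1⟩
  have hB := hQ (T.image b) fun y hy => by
    obtain ⟨x, hx, rfl⟩ := Finset.mem_image.1 hy
    exact ⟨(hab x hx).2.1, (hsize x hx).2⟩
  have hsum0 : ∀ U : Finset MarkedClass, 0 ≤ ∑ x ∈ U, weight x := fun U =>
    Finset.sum_nonneg fun x _ => (weight_pos x).le
  calc ∑ x ∈ T, weight x
      = ∑ p ∈ T.image fun x => (a x, b x), weight p.1 * weight p.2 := by
        rw [Finset.sum_image hinj]
        refine Finset.sum_congr rfl fun x hx => ?_
        rw [← weight_comb j k, ← (hab x hx).2.2]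
    _ ≤ ∑ p ∈ T.image a ×ˢ T.image b, weight p.1 * weight p.2 := by
        refine Finset.sum_le_sum_of_subset_of_nonneg ?_ fun p _ _ =>
          (mul_pos (weight_pos _) (weight_pos _)).le
        intro p hp
        obtain ⟨x, hx, rfl⟩ := Finset.mem_image.1 hp
        exact Finset.mk_mem_product (Finset.mem_image_of_mem a hx) (Finset.mem_image_of_mem b hx)
    _ = (∑ x ∈ T.image a, weight x) * ∑ y ∈ T.image b, weight y := by
        rw [Finset.sum_mul_sum, Finset.sum_product]
    _ ≤ c * d := mul_le_mul hA hB (hsum0 _) ((hsum0 _).trans hA)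

theorem size_lt_of_mem_combAll {j : Bool} {s : Multiset MarkedClass} (hs : 2 ≤ s.card)
    (hpos : ∀ b ∈ s, 0 < size b) {b : MarkedClass} (hb : b ∈ s) : size b < size (combAll j s) := by
  obtain ⟨t, rfl⟩ := Multiset.exists_cons_of_mem hb
  rw [Multiset.card_cons] at hs
  obtain ⟨c, hc⟩ := Multiset.card_pos_iff_exists_mem.1 (by omega : 0 < t.card)
  obtain ⟨t, rfl⟩ := Multiset.exists_cons_of_mem hc
  have := hpos c (by simp)
  rw [size_combAll, Multiset.map_cons, Multiset.map_cons, Multiset.sum_cons, Multiset.sum_cons]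
  omega

theorem weightBound_combAll {Q : MarkedClass → Prop} {N : ℕ} (j : Bool)
    (hQ : WeightBound Q N (7 / 48)) (hQ2 : ∀ x, Q x → 2 ≤ size x) :
    WeightBound (fun x => ∃ s : Multiset MarkedClass, 2 ≤ s.card ∧
      (∀ b ∈ s, b = ⟦MarkedGraph.point⟧ ∨ Q b) ∧ x = combAll j s) (N + 1) (1 / 16) := by
  classical
  intro T hT
  choose! s hcard hmem hval using fun x hx => (hT x hx).1
  have hinj : Set.InjOn s T := fun x hx y hy hxy => by rw [hval x hx, hval y hy, hxy]
  let R := (T.biUnion fun x => (s x).toFinset).erase ⟦MarkedGraph.point⟧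
  let B := insert ⟦MarkedGraph.point⟧ R
  have hR : ∀ b ∈ R, Q b ∧ size b ≤ N := by
    intro b hb
    simp only [R, Finset.mem_erase, Finset.mem_biUnion, Multiset.mem_toFinset] at hb
    obtain ⟨hne, x, hx, hbx⟩ := hb
    refine ⟨(hmem x hx b hbx).resolve_left hne, ?_⟩
    have h1 := size_lt_of_mem_combAll (j := j) (hcard x hx) (fun c hc => by
      rcases hmem x hx c hc with rfl | h
      · rw [size_point]
        exact one_pos
      · exact two_pos.trans_le (hQ2 c h)) hbx
    have h2 := (hT x hx).2
    rw [← hval x hx] at h1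
    omega
  have hTB : ∀ x ∈ T, ∀ b ∈ s x, b ∈ B := by
    intro x hx b hb
    by_cases hbp : b = ⟦MarkedGraph.point⟧
    · exact hbp ▸ Finset.mem_insert_self _ _
    · exact Finset.mem_insert_of_mem (Finset.mem_erase.2
        ⟨hbp, Finset.mem_biUnion.2 ⟨x, hx, Multiset.mem_toFinset.2 hb⟩⟩)
  have hpR : ⟦MarkedGraph.point⟧ ∉ R := Finset.notMem_erase _ _
  let small : Finset (Multiset MarkedClass) := insert 0 (B.image fun b => {b})
  have hsmall : ∀ t ∈ small, t.card ≤ 1 ∧ ∀ b ∈ t, b ∈ B := by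
    intro t ht
    rcases Finset.mem_insert.1 ht with rfl | ht
    · simp
    · obtain ⟨b, hb, rfl⟩ := Finset.mem_image.1 ht
      simpa using hb
  have hdisj : Disjoint (T.image s) small := by
    rw [Finset.disjoint_left]
    intro t ht ht'
    obtain ⟨x, hx, rfl⟩ := Finset.mem_image.1 ht
    have h1 := hcard x hx
    have h2 := (hsmall _ ht').1
    omega
  have hsum_small : ∑ t ∈ small, (t.map weight).prod = 1 + ∑ b ∈ B, weight b := by
    rw [Finset.sum_insert (by simp), Finset.sum_image (by simp)]
    simp
  have hsum_T : ∑ t ∈ T.image s, (t.map weight).prod = ∑ x ∈ T, weight x := by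
    rw [Finset.sum_image hinj]
    refine Finset.sum_congr rfl fun x hx => ?_
    rw [← weight_combAll j, ← hval x hx]
  have hsum_B : ∑ b ∈ B, weight b = 1 / 8 + ∑ b ∈ R, weight b := by
    rw [Finset.sum_insert hpR, weight_point]
  have hwR : ∀ b ∈ R, weight b ≤ 1 / 64 := fun b hb =>
    (weight_le_of_le_size (hQ2 b (hR b hb).1)).trans_eq (by norm_num)
  have hmain := Finset.sum_prod_multiset_le B weight (fun b _ => (weight_pos b).le)
    (fun b hb => by
      rcases Finset.mem_insert.1 hb with rfl | hb
      · rw [weight_point]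
        norm_num
      · linarith [hwR b hb]) (T.image s ∪ small) (fun t ht => by
      rcases Finset.mem_union.1 ht with ht | ht
      · obtain ⟨x, hx, rfl⟩ := Finset.mem_image.1 ht
        exact hTB x hx
      · exact (hsmall t ht).2)
  rw [Finset.sum_union hdisj, hsum_small, hsum_T, hsum_B, Finset.prod_insert hpR,
    weight_point] at hmain
  have h1 := prod_inv_one_sub_le_exp R weight (fun b _ => (weight_pos b).le) hwR
  have h2 := exp_bound_of_le (Finset.sum_nonneg fun b _ => (weight_pos b).le) (hQ R hR)
  norm_num at hmain h1 h2 ⊢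
  linarith

/-- The classes obtained by a combination of two constructible ones. -/
def Combined (j k : Bool) (x : MarkedClass) : Prop :=
  ∃ a b, Constructible a ∧ Constructible b ∧ x = comb j k a b

theorem Combined.two_le_size {j k : Bool} {x : MarkedClass} (hx : Combined j k x) :
    2 ≤ size x := by
  obtain ⟨a, b, ha, hb, rfl⟩ := hx
  have := ha.size_pos
  have := hb.size_pos
  rw [size_comb]
  omega

/-- A constructible class is a combination of classes not obtained by that combination. -/
theorem Constructible.exists_combAll {x : MarkedClass} (hx : Constructible x) (j : Bool) :
    ∃ s : Multiset MarkedClass, 1 ≤ s.card ∧ (∀ b ∈ s, b = ⟦MarkedGraph.point⟧ ∨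
      (Combined (!j) true b ∨ Combined true false b)) ∧ x = combAll j s := by
  induction hx with
  | point => exact ⟨{⟦MarkedGraph.point⟧}, by simp, by simp, (combAll_singleton _ _).symm⟩
  | @comb j' k h x y hx hy ih1 ih2 =>
    by_cases hjk : k = true ∧ j' = j
    · obtain ⟨rfl, rfl⟩ := hjk
      obtain ⟨s, hs1, hs2, hs3⟩ := ih1
      obtain ⟨t, ht1, ht2, ht3⟩ := ih2
      refine ⟨s + t, by rw [Multiset.card_add]; omega, fun b hb => ?_, ?_⟩
      · exact (Multiset.mem_add.1 hb).elim (hs2 b) (ht2 b)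
      · rw [combAll_add, ← hs3, ← ht3]
    · refine ⟨{MarkedClass.comb j' k x y}, by simp, fun b hb => ?_, (combAll_singleton _ _).symm⟩
      rw [Multiset.mem_singleton.1 hb]
      right
      cases k with
      | false =>
        obtain rfl : j' = true := by simpa using h
        exact Or.inr ⟨x, y, hx, hy, rfl⟩
      | true =>
        obtain rfl : j' = !j := by simpa [Bool.eq_not] using hjk
        exact Or.inl ⟨x, y, hx, hy, rfl⟩

theorem Combined.exists_combAll {j : Bool} {x : MarkedClass} (hx : Combined j true x) :
    ∃ s : Multiset MarkedClass, 2 ≤ s.card ∧ (∀ b ∈ s, b = ⟦MarkedGraph.point⟧ ∨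
      (Combined (!j) true b ∨ Combined true false b)) ∧ x = combAll j s := by
  obtain ⟨a, b, ha, hb, rfl⟩ := hx
  obtain ⟨s, hs1, hs2, hs3⟩ := ha.exists_combAll j
  obtain ⟨t, ht1, ht2, ht3⟩ := hb.exists_combAll j
  refine ⟨s + t, by rw [Multiset.card_add]; omega, fun b hb => ?_, ?_⟩
  · exact (Multiset.mem_add.1 hb).elim (hs2 b) (ht2 b)
  · rw [combAll_add, ← hs3, ← ht3]

theorem Constructible.cases {x : MarkedClass} (hx : Constructible x) :
    (x = ⟦MarkedGraph.point⟧ ∨ (Combined true true x ∨ Combined false true x)) ∨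
      Combined true false x := by
  cases hx with
  | point => exact Or.inl (Or.inl rfl)
  | comb j k h hx hy =>
    cases k with
    | false =>
      obtain rfl : j = true := by simpa using h
      exact Or.inr ⟨_, _, hx, hy, rfl⟩
    | true =>
      cases j with
      | false => exact Or.inl (Or.inr (Or.inr ⟨_, _, hx, hy, rfl⟩))
      | true => exact Or.inl (Or.inr (Or.inl ⟨_, _, hx, hy, rfl⟩))

/-- Successive attachments of pendant parts can be replaced by one. -/
theorem Constructible.exists_pendant {x y : MarkedClass} (hx : Constructible x)
    (hy : Constructible y) : ∃ a b,
      (a = ⟦MarkedGraph.point⟧ ∨ (Combined true true a ∨ Combined false true a)) ∧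
      Constructible b ∧
      MarkedClass.comb true false x y = MarkedClass.comb true false a b := by
  induction hx generalizing y with
  | point => exact ⟨_, y, Or.inl rfl, hy, rfl⟩
  | @comb j k h c d hc hd ihc _ =>
    rcases (Constructible.comb j k h hc hd).cases with hcd | hcd
    · exact ⟨_, y, hcd, hy, rfl⟩
    · cases k with
      | false =>
        obtain rfl : j = true := by simpa using h
        obtain ⟨a, b, ha, hb, hab⟩ := ihc (.comb false true rfl hd hy)
        exact ⟨a, b, ha, hb, by rw [comb_pendant_assoc, hab]⟩
      | true =>
        cases j with
        | false => exact ⟨_, y, Or.inr (Or.inr ⟨c, d, hc, hd, rfl⟩), hy, rfl⟩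
        | true => exact ⟨_, y, Or.inr (Or.inl ⟨c, d, hc, hd, rfl⟩), hy, rfl⟩

theorem WeightBound.mono {P Q : MarkedClass → Prop} {N : ℕ} {c d : ℝ} (hQ : WeightBound Q N c)
    (hPQ : ∀ x, P x → Q x) (hcd : c ≤ d) : WeightBound P N d :=
  fun T hT => (hQ T fun x hx => ⟨hPQ x (hT x hx).1, (hT x hx).2⟩).trans hcd

theorem weightBound_combined (N : ℕ) :
    (∀ j, WeightBound (Combined j true) N (1 / 16)) ∧
      WeightBound (Combined true false) N (1 / 12) := by
  induction N with
  | zero =>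
    have : ∀ j k, ∀ c : ℝ, 0 ≤ c → WeightBound (Combined j k) 0 c := by
      intro j k c hc T hT
      rw [Finset.sum_eq_zero fun x hx => ?_]
      · exact hc
      · have h1 := (hT x hx).1.two_le_size
        have h2 := (hT x hx).2
        omega
    exact ⟨fun j => this j true _ (by norm_num), this _ _ _ (by norm_num)⟩
  | succ N ih =>
    obtain ⟨ih1, ih2⟩ := ih
    refine ⟨fun j => ?_, ?_⟩
    · refine (weightBound_combAll j (((ih1 !j).or ih2).mono (fun _ h => h) (by norm_num))
        fun x hx => ?_).mono (fun x hx => hx.exists_combAll) le_rfl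
      exact hx.elim Combined.two_le_size Combined.two_le_size
    · have hL := (weightBound_point N).or ((ih1 true).or (ih1 false))
      refine (weightBound_comb true false hL (hL.or ih2) ?_ ?_).mono (fun x hx => ?_)
        (by norm_num)
      · rintro x (rfl | hx | hx)
        · exact Constructible.point.size_pos
        · exact two_pos.trans_le hx.two_le_size
        · exact two_pos.trans_le hx.two_le_size
      · rintro x ((rfl | hx | hx) | hx)
        · exact Constructible.point.size_pos
        · exact two_pos.trans_le hx.two_le_size
        · exact two_pos.trans_le hx.two_le_size
        · exact two_pos.trans_le hx.two_le_size
      · obtain ⟨c, d, hc, hd, rfl⟩ := hx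
        obtain ⟨a, b, ha, hb, hab⟩ := hc.exists_pendant hd
        exact ⟨a, b, ha, hb.cases, hab⟩

theorem weightBound_constructible (N : ℕ) : WeightBound Constructible N (1 / 3) := by
  obtain ⟨h1, h2⟩ := weightBound_combined N
  exact (((weightBound_point N).or ((h1 true).or (h1 false))).or h2).mono
    (fun x hx => hx.cases) (by norm_num)

theorem card_le_of_constructible {n : ℕ} (T : Finset MarkedClass)
    (hT : ∀ x ∈ T, Constructible x ∧ size x = n) : T.card ≤ 8 ^ n := by
  have h1 := weightBound_constructible n T fun x hx => ⟨(hT x hx).1, (hT x hx).2.le⟩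
  have h2 : ∑ x ∈ T, weight x = T.card * (1 / 8) ^ n := by
    rw [Finset.sum_congr rfl fun x hx => show weight x = (1 / 8) ^ n by rw [weight, (hT x hx).2],
      Finset.sum_const, nsmul_eq_mul]
  rw [h2, one_div_pow, mul_one_div, div_le_iff₀ (by positivity)] at h1
  have h3 : (T.card : ℝ) ≤ 8 ^ n := h1.trans (by linarith [show (0 : ℝ) < 8 ^ n by positivity])
  exact_mod_cast h3

end MarkedClass

end Counting

theorem numConnDH_le_two_pow_three_n :
    ∀ n : ℕ, 1 ≤ n → numConnDH n ≤ 2 ^ (3 * n) := by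
  classical
  intro n _
  choose S hS using fun G : {G : SimpleGraph (Fin n) // G.Connected ∧ DistanceHereditary G} =>
    G.2.2.exists_constructible G.2.1
  let f : Quot (fun (G G' : {G : SimpleGraph (Fin n) // G.Connected ∧ DistanceHereditary G}) =>
    Nonempty (G.val ≃g G'.val)) → MarkedClass :=
    fun q => ⟦⟨Fin n, inferInstance, q.out.1, S q.out⟩⟧
  have hf : Function.Injective f := by
    intro p q hpq
    obtain ⟨e, he, _⟩ := Quotient.exact hpq
    rw [← Quot.out_eq p, ← Quot.out_eq q]
    exact Quot.sound ⟨⟨e, he _ _⟩⟩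
  have := Fintype.ofFinite (Quot
    (fun (G G' : {G : SimpleGraph (Fin n) // G.Connected ∧ DistanceHereditary G}) =>
      Nonempty (G.val ≃g G'.val)))
  rw [numConnDH, Nat.card_eq_fintype_card, ← Finset.card_univ,
    ← Finset.card_image_of_injective _ hf, pow_mul]
  refine MarkedClass.card_le_of_constructible _ fun x hx => ?_
  obtain ⟨q, _, rfl⟩ := Finset.mem_image.1 hx
  exact ⟨hS q.out, Nat.card_fin n⟩
end

section
/- Let L(n) denote the number of isomorphism classes of connected 3-leaf power simple graphs on n vertices. There exist real constants c > 0, C > 0 and a natural number N such that for all n ≥ N, c · 3.848^n · n^(−5/2) ≤ L(n) ≤ C · 3.849^n · n^(−5/2). -/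
/-- A vertex of a simple graph is a leaf if it has exactly one neighbour. -/
def IsLeafVert {V : Type} (T : SimpleGraph V) (v : V) : Prop :=
  ∃! u, T.Adj v u

/-- A simple graph `G` is a 3-leaf power if there are a finite tree `T` and a bijection
from the vertices of `G` onto the leaves of `T` such that two distinct vertices of `G`
are adjacent iff the corresponding leaves are at distance at most 3 in `T`. -/
def IsThreeLeafPower {V : Type} (G : SimpleGraph V) : Prop :=
  ∃ (m : ℕ) (T : SimpleGraph (Fin m)), T.IsTree ∧
    ∃ f : V → Fin m,
      Function.Injective f ∧
      (∀ v : V, IsLeafVert T (f v)) ∧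
      (∀ w : Fin m, IsLeafVert T w → ∃ v : V, f v = w) ∧
      (∀ x y : V, x ≠ y → (G.Adj x y ↔ T.dist (f x) (f y) ≤ 3))

/-- The number of isomorphism classes of connected 3-leaf power simple graphs
on `n` vertices. -/
noncomputable def numConn3LP (n : ℕ) : ℕ :=
  Nat.card (Quot (fun (G G' : {G : SimpleGraph (Fin n) // G.Connected ∧ IsThreeLeafPower G}) =>
    Nonempty (G.val ≃g G'.val)))

/-- Rooted weighted trees are coded by natural numbers: a tree is given by the excess weight of its
root and the multiset of the codes of the subtrees at the children of the root. -/
def nodeEquiv : ℕ × Multiset ℕ ≃ ℕ :=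
  ((Equiv.refl ℕ).prodCongr (Denumerable.eqv (Multiset ℕ))).trans Nat.pairEquiv

lemma mem_raise_le_sum (l : List ℕ) (n a : ℕ) (h : a ∈ Denumerable.raise l n) :
    a ≤ n + l.sum := by
  induction l generalizing n with
  | nil => simp [Denumerable.raise] at h
  | cons m l ih =>
    simp only [Denumerable.raise, List.mem_cons] at h
    rcases h with rfl | h
    · simp; omega
    · have := ih _ h
      simp; omega

lemma mem_raise_lt_encode (l : List ℕ) (a : ℕ) (h : a ∈ Denumerable.raise l 0) :
    a < Encodable.encode l := by
  have key : ∀ l : List ℕ, l ≠ [] → l.sum < Encodable.encode l := by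
    intro l
    induction l with
    | nil => simp
    | cons m l ih =>
      intro _
      have h1 := Nat.add_le_pair m (Encodable.encode l)
      rw [Encodable.encode_list_cons, Encodable.encode_nat, List.sum_cons]
      by_cases hl : l = []
      · subst hl
        simp at h1 ⊢
        omega
      · have := ih hl
        omega
  have hl : l ≠ [] := by
    rintro rfl
    simp [Denumerable.raise] at h
  have := mem_raise_le_sum l 0 a h
  have := key l hl
  omega

lemma lt_nodeEquiv {w a : ℕ} {M : Multiset ℕ} (h : a ∈ M) : a < nodeEquiv (w, M) := by
  have h1 : a < Denumerable.eqv (Multiset ℕ) M := by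
    obtain ⟨n, rfl⟩ := (Denumerable.eqv (Multiset ℕ)).symm.surjective M
    rw [Equiv.apply_symm_apply]
    have : (Denumerable.eqv (Multiset ℕ)).symm n = Multiset.map (Denumerable.ofNat ℕ)
      ((Denumerable.raise (Denumerable.ofNat (List ℕ) n) 0 : List ℕ) : Multiset ℕ) := rfl
    rw [this] at h
    rw [Multiset.map_coe, Multiset.mem_coe, List.mem_map] at h
    obtain ⟨b, hb, rfl⟩ := h
    have := mem_raise_lt_encode _ _ hb
    simpa using this
  have h2 : nodeEquiv (w, M) = Nat.pair w (Denumerable.eqv (Multiset ℕ) M) := rfl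
  have := Nat.add_le_pair w (Denumerable.eqv (Multiset ℕ) M)
  omega

/-- The total weight of the tree with a given code. -/
def codeSize (q : ℕ) : ℕ :=
  (nodeEquiv.symm q).1 + 1 +
    (((nodeEquiv.symm q).2.attach).map fun (a : {x // x ∈ (nodeEquiv.symm q).2}) =>
    have : a.1 < q := by
      have h := lt_nodeEquiv (w := (nodeEquiv.symm q).1) a.2
      simpa using h
    codeSize a.1).sum
termination_by q

lemma codeSize_nodeEquiv (w : ℕ) (M : Multiset ℕ) :
    codeSize (nodeEquiv (w, M)) = w + 1 + (M.map codeSize).sum := by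
  rw [codeSize]
  have : ∀ p : ℕ × Multiset ℕ, p = (w, M) →
      p.1 + 1 + (p.2.attach.map fun a => codeSize a.1).sum = w + 1 + (M.map codeSize).sum := by
    rintro p rfl
    simp
  exact this _ (by simp)

lemma codeSize_pos (q : ℕ) : 0 < codeSize q := by
  obtain ⟨⟨w, M⟩, rfl⟩ := nodeEquiv.surjective q
  rw [codeSize_nodeEquiv]; omega

lemma hasSum_mul_of_nonneg {ι κ : Type} {f : ι → ℝ} {g : κ → ℝ} {a b : ℝ} (hf : HasSum f a)
    (hg : HasSum g b) (hf0 : ∀ i, 0 ≤ f i) (hg0 : ∀ i, 0 ≤ g i) :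
    HasSum (fun p : ι × κ => f p.1 * g p.2) (a * b) :=
  hf.mul hg (hf.summable.mul_of_nonneg hg.summable hf0 hg0)

lemma hasSum_prod_geometric {N : ℕ} (a : Fin N → ℝ) (h0 : ∀ i, 0 ≤ a i) (h1 : ∀ i, a i < 1) :
    HasSum (fun f : Fin N → ℕ => ∏ i, a i ^ f i) (∏ i, (1 - a i)⁻¹) := by
  induction N with
  | zero => simp
  | succ N ih =>
    have h2 := ih (fun i => a i.succ) (fun i => h0 _) (fun i => h1 _)
    have h3 := hasSum_geometric_of_lt_one (h0 0) (h1 0)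
    have h4 := hasSum_mul_of_nonneg h3 h2
      (fun k => pow_nonneg (h0 0) k) (fun f => Finset.prod_nonneg fun i _ => pow_nonneg (h0 _) _)
    rw [Fin.prod_univ_succ]
    rw [← (Fin.consEquiv (fun _ : Fin (N + 1) => ℕ)).hasSum_iff]
    convert h4 using 1
    ext ⟨k, f⟩
    simp [Fin.prod_univ_succ]

/-- The multiset over `range N` with given multiplicities. -/
def multisetOfCounts {N : ℕ} (f : Fin N → ℕ) : Multiset ℕ :=
  ∑ i : Fin N, Multiset.replicate (f i) (i : ℕ)

lemma count_multisetOfCounts {N : ℕ} (f : Fin N → ℕ) (i : Fin N) :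
    (multisetOfCounts f).count (i : ℕ) = f i := by
  simp [multisetOfCounts, Multiset.count_sum', Multiset.count_replicate, Fin.val_inj]

lemma multisetOfCounts_injective {N : ℕ} :
    Function.Injective (multisetOfCounts : (Fin N → ℕ) → Multiset ℕ) := by
  intro f g h
  ext i
  rw [← count_multisetOfCounts f, h, count_multisetOfCounts]

lemma multisetOfCounts_count {N : ℕ} (M : Multiset ℕ) (hM : ∀ a ∈ M, a < N) :
    multisetOfCounts (fun i : Fin N => M.count (i : ℕ)) = M := by
  ext a
  by_cases ha : a < N
  · exact count_multisetOfCounts (fun i : Fin N => M.count (i : ℕ)) ⟨a, ha⟩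
  · rw [Multiset.count_eq_zero_of_notMem fun h => ha (hM a h)]
    simp only [multisetOfCounts, Multiset.count_sum', Multiset.count_replicate]
    refine Finset.sum_eq_zero fun i _ => ?_
    rw [if_neg]
    have := i.2
    omega

lemma pow_codeSize_multisetOfCounts {N : ℕ} (y : ℝ) (w : ℕ) (f : Fin N → ℕ) :
    y ^ codeSize (nodeEquiv (w, multisetOfCounts f)) =
      y ^ (w + 1) * ∏ i : Fin N, (y ^ codeSize i) ^ f i := by
  have : ((multisetOfCounts f).map codeSize).sum = ∑ i : Fin N, f i * codeSize i := by
    unfold multisetOfCounts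
    rw [← Multiset.coe_mapAddMonoidHom, map_sum, ← Multiset.coe_sumAddMonoidHom, map_sum]
    simp
  rw [codeSize_nodeEquiv, pow_add, this, ← Finset.prod_pow_eq_pow_sum]
  congr 1
  refine Finset.prod_congr rfl fun i _ => ?_
  rw [← pow_mul, mul_comm]

lemma pow_codeSize_lt_one {y : ℝ} (h0 : 0 ≤ y) (h1 : y < 1) (q : ℕ) : y ^ codeSize q < 1 :=
  pow_lt_one₀ h0 h1 (codeSize_pos q).ne'

lemma hasSum_node {N : ℕ} {y : ℝ} (h0 : 0 ≤ y) (h1 : y < 1) :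
    HasSum (fun p : ℕ × (Fin N → ℕ) => y ^ codeSize (nodeEquiv (p.1, multisetOfCounts p.2)))
      (y / (1 - y) * ∏ q ∈ Finset.range N, (1 - y ^ codeSize q)⁻¹) := by
  have h2 := (hasSum_geometric_of_lt_one h0 h1).mul_left y
  have h3 := hasSum_prod_geometric (fun i : Fin N => y ^ codeSize i) (fun i => pow_nonneg h0 _)
    (fun i => pow_codeSize_lt_one h0 h1 i)
  have h4 := hasSum_mul_of_nonneg h2 h3
    (fun k => mul_nonneg h0 (pow_nonneg h0 k))
    (fun f => Finset.prod_nonneg fun i _ => pow_nonneg (pow_nonneg h0 _) _)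
  rw [Finset.prod_range, div_eq_mul_inv]
  convert h4 using 1
  ext ⟨w, f⟩
  rw [pow_codeSize_multisetOfCounts, pow_succ']

/-- The generating function of the trees with code below `N`. -/
noncomputable def treeSum (N : ℕ) (y : ℝ) : ℝ :=
  ∑ q ∈ Finset.range N, y ^ codeSize q

lemma treeSum_succ_le (N : ℕ) {y : ℝ} (h0 : 0 ≤ y) (h1 : y < 1) :
    treeSum (N + 1) y ≤ y / (1 - y) * ∏ q ∈ Finset.range N, (1 - y ^ codeSize q)⁻¹ := by
  classical
  set g : ℕ → ℕ × (Fin N → ℕ) := fun q =>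
    ((nodeEquiv.symm q).1, fun i => (nodeEquiv.symm q).2.count (i : ℕ)) with hg
  have key : ∀ q ∈ Finset.range (N + 1),
      nodeEquiv ((g q).1, multisetOfCounts (g q).2) = q := by
    intro q hq
    obtain ⟨⟨w, M⟩, rfl⟩ := nodeEquiv.surjective q
    simp only [hg, Equiv.symm_apply_apply]
    rw [multisetOfCounts_count]
    intro a ha
    have := lt_nodeEquiv (w := w) ha
    have := Finset.mem_range.1 hq
    omega
  have hinj : Set.InjOn g (Finset.range (N + 1)) := by
    intro q hq q' hq' h
    rw [← key q hq, h, key q' hq']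
  have := sum_le_hasSum ((Finset.range (N + 1)).image g)
    (fun _ _ => pow_nonneg h0 _) (hasSum_node (N := N) h0 h1)
  rw [Finset.sum_image hinj] at this
  refine le_trans (le_of_eq ?_) this
  refine Finset.sum_congr rfl fun q hq => ?_
  rw [key q hq]

lemma le_tsum_pow_codeSize (N : ℕ) {y : ℝ} (h0 : 0 ≤ y) (h1 : y < 1)
    (hs : Summable fun q => y ^ codeSize q) :
    y / (1 - y) * ∏ q ∈ Finset.range N, (1 - y ^ codeSize q)⁻¹ ≤ ∑' q, y ^ codeSize q := by
  rw [← (hasSum_node (N := N) h0 h1).tsum_eq]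
  refine tsum_comp_le_tsum_of_inj (i := fun p : ℕ × (Fin N → ℕ) =>
    nodeEquiv (p.1, multisetOfCounts p.2)) hs (fun _ => pow_nonneg h0 _) ?_
  rintro ⟨w, f⟩ ⟨w', f'⟩ h
  have := nodeEquiv.injective h
  simp only [Prod.mk.injEq] at this
  exact Prod.ext this.1 (multisetOfCounts_injective this.2)

lemma prod_inv_one_sub_eq (N : ℕ) {y : ℝ} (h0 : 0 ≤ y) (h1 : y < 1) :
    ∏ q ∈ Finset.range N, (1 - y ^ codeSize q)⁻¹ =
      Real.exp (∑ q ∈ Finset.range N, -Real.log (1 - y ^ codeSize q)) := by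
  rw [Real.exp_sum]
  refine Finset.prod_congr rfl fun q _ => ?_
  rw [Real.exp_neg, Real.exp_log (sub_pos.2 (pow_codeSize_lt_one h0 h1 q))]

lemma sum_pow_div_le_neg_log {a : ℝ} (n : ℕ) (h0 : 0 ≤ a) (h1 : a < 1) :
    ∑ k ∈ Finset.range n, a ^ (k + 1) / ((k : ℝ) + 1) ≤ -Real.log (1 - a) :=
  sum_le_hasSum _ (fun k _ => by positivity)
    (Real.hasSum_pow_div_log_of_abs_lt_one (by rwa [abs_of_nonneg h0]))

lemma neg_log_le_sum_pow_div {a : ℝ} (n : ℕ) (h0 : 0 ≤ a) (h1 : a < 1) :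
    -Real.log (1 - a) ≤
      ∑ k ∈ Finset.range n, a ^ (k + 1) / ((k : ℝ) + 1) + a ^ (n + 1) / (1 - a) := by
  have := (abs_le.1 (Real.abs_log_sub_add_sum_range_le
    (show |a| < 1 by rwa [abs_of_nonneg h0]) n)).1
  rw [abs_of_nonneg h0] at this
  linarith

lemma sum_sum_pow_div (N n : ℕ) (y : ℝ) :
    ∑ q ∈ Finset.range N, ∑ k ∈ Finset.range n, (y ^ codeSize q) ^ (k + 1) / ((k : ℝ) + 1) =
      ∑ k ∈ Finset.range n, treeSum N (y ^ (k + 1)) / ((k : ℝ) + 1) := by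
  rw [Finset.sum_comm]
  refine Finset.sum_congr rfl fun k _ => ?_
  rw [treeSum, Finset.sum_div]
  refine Finset.sum_congr rfl fun q _ => ?_
  rw [← pow_mul, ← pow_mul, mul_comm]

lemma treeSum_succ_le_exp (N n : ℕ) {y : ℝ} (h0 : 0 ≤ y) (h1 : y < 1) :
    treeSum (N + 1) y ≤ y / (1 - y) * Real.exp (∑ k ∈ Finset.range n,
      treeSum N (y ^ (k + 1)) / ((k : ℝ) + 1) + treeSum N (y ^ (n + 1)) / (1 - y)) := by
  refine (treeSum_succ_le N h0 h1).trans ?_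
  rw [prod_inv_one_sub_eq N h0 h1, ← sum_sum_pow_div, treeSum, Finset.sum_div,
    ← Finset.sum_add_distrib]
  refine mul_le_mul_of_nonneg_left (Real.exp_le_exp.2 (Finset.sum_le_sum fun q _ => ?_))
    (div_nonneg h0 (by linarith))
  refine (neg_log_le_sum_pow_div n (pow_nonneg h0 _) (pow_codeSize_lt_one h0 h1 q)).trans ?_
  refine add_le_add le_rfl ?_
  rw [← pow_mul, ← pow_mul, mul_comm]
  have : y ^ codeSize q ≤ y := pow_le_of_le_one h0 h1.le (codeSize_pos q).ne'
  have : 0 < 1 - y := by linarith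
  gcongr

lemma treeSum_mono_right (N : ℕ) {y z : ℝ} (h0 : 0 ≤ y) (h : y ≤ z) :
    treeSum N y ≤ treeSum N z :=
  Finset.sum_le_sum fun _ _ => pow_le_pow_left₀ h0 h _

lemma exp_le_tsum_pow_codeSize (n : ℕ) {y : ℝ} (h0 : 0 ≤ y) (h1 : y < 1)
    (hs : Summable fun q => y ^ codeSize q) :
    y / (1 - y) * Real.exp (∑ k ∈ Finset.range n,
      (∑' q, (y ^ (k + 1)) ^ codeSize q) / ((k : ℝ) + 1)) ≤ ∑' q, y ^ codeSize q := by
  have hN : ∀ N, y / (1 - y) * Real.exp (∑ k ∈ Finset.range n,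
      treeSum N (y ^ (k + 1)) / ((k : ℝ) + 1)) ≤ ∑' q, y ^ codeSize q := by
    intro N
    refine le_trans ?_ (le_tsum_pow_codeSize N h0 h1 hs)
    rw [prod_inv_one_sub_eq N h0 h1, ← sum_sum_pow_div]
    refine mul_le_mul_of_nonneg_left (Real.exp_le_exp.2 (Finset.sum_le_sum fun q _ => ?_))
      (div_nonneg h0 (by linarith))
    exact sum_pow_div_le_neg_log n (pow_nonneg h0 _) (pow_codeSize_lt_one h0 h1 q)
  refine le_of_tendsto' (x := Filter.atTop) ?_ hN
  refine Filter.Tendsto.const_mul _ ((Real.continuous_exp.tendsto _).comp ?_)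
  refine tendsto_finsetSum _ fun k _ => Filter.Tendsto.div_const ?_ _
  refine Summable.tendsto_sum_tsum_nat ?_
  refine Summable.of_nonneg_of_le (fun q => by positivity) (fun q => ?_) hs
  exact pow_le_pow_left₀ (by positivity) (pow_le_of_le_one h0 h1.le (by omega)) _

lemma treeSum_le_of_exp_le (n : ℕ) {y t E : ℝ} (h0 : 0 ≤ y) (h1 : y < 1)
    (hE : ∀ N, ∑ k ∈ Finset.range n, treeSum N (y ^ (k + 2)) / ((k : ℝ) + 2) +
      treeSum N (y ^ (n + 2)) / (1 - y) ≤ E)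
    (h : y / (1 - y) * Real.exp (t + E) ≤ t) (N : ℕ) : treeSum N y ≤ t := by
  have hy : 0 ≤ y / (1 - y) := div_nonneg h0 (by linarith)
  induction N with
  | zero => exact le_trans (by simp [treeSum]) ((mul_nonneg hy (Real.exp_pos _).le).trans h)
  | succ N ih =>
    refine (treeSum_succ_le_exp N (n + 1) h0 h1).trans (le_trans ?_ h)
    refine mul_le_mul_of_nonneg_left (Real.exp_le_exp.2 ?_) hy
    rw [Finset.sum_range_succ']
    have := hE N
    have h2 : ∀ k : ℕ, ((k + 1 : ℕ) : ℝ) + 1 = (k : ℝ) + 2 := by intro k; push_cast; ring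
    simp only [h2, add_assoc, Nat.reduceAdd, zero_add, pow_one, Nat.cast_zero, div_one] at this ⊢
    linarith

lemma treeSum_le_of_exp_le_crude {y t : ℝ} (h0 : 0 ≤ y) (h1 : y < 1)
    (h : y / (1 - y) * Real.exp (t / (1 - y)) ≤ t) (N : ℕ) : treeSum N y ≤ t := by
  have hy : 0 ≤ y / (1 - y) := div_nonneg h0 (by linarith)
  induction N with
  | zero => exact le_trans (by simp [treeSum]) ((mul_nonneg hy (Real.exp_pos _).le).trans h)
  | succ N ih =>
    refine (treeSum_succ_le_exp N 0 h0 h1).trans (le_trans ?_ h)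
    refine mul_le_mul_of_nonneg_left (Real.exp_le_exp.2 ?_) hy
    have : 0 < 1 - y := by linarith
    simp only [Finset.range_zero, Finset.sum_empty, zero_add, pow_one]
    gcongr

lemma exp_le_quartic {u : ℝ} (h0 : 0 ≤ u) (h1 : u ≤ 1) :
    Real.exp u ≤ 1 + u + u ^ 2 / 2 + u ^ 3 / 6 + 5 * u ^ 4 / 96 := by
  have := Real.exp_bound' h0 h1 (n := 4) (by norm_num)
  norm_num [Finset.sum_range_succ, Nat.factorial] at this
  linarith

lemma cubic_le_exp {u : ℝ} (h0 : 0 ≤ u) : 1 + u + u ^ 2 / 2 + u ^ 3 / 6 ≤ Real.exp u := by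
  have := Real.sum_le_exp_of_nonneg h0 4
  norm_num [Finset.sum_range_succ, Nat.factorial] at this
  linarith

lemma treeSum_pow_le {x y t : ℝ} (k : ℕ) (hx : 0 ≤ x) (hxy : x ^ k ≤ y) (h1 : y < 1)
    (ht : 0 ≤ t) (htu : t / (1 - y) ≤ 1)
    (h : y / (1 - y) * (1 + t / (1 - y) + (t / (1 - y)) ^ 2 / 2 + (t / (1 - y)) ^ 3 / 6 +
      5 * (t / (1 - y)) ^ 4 / 96) ≤ t) (N : ℕ) : treeSum N (x ^ k) ≤ t := by
  have h0 : 0 ≤ y := (pow_nonneg hx k).trans hxy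
  have h1' : 0 < 1 - y := by linarith
  refine (treeSum_mono_right N (pow_nonneg hx k) hxy).trans
    (treeSum_le_of_exp_le_crude h0 h1 (le_trans ?_ h) N)
  exact mul_le_mul_of_nonneg_left (exp_le_quartic (div_nonneg ht h1'.le) htu)
    (div_nonneg h0 h1'.le)

/-- The generating function of rooted weighted trees is at most `1` slightly inside the disc of
convergence. -/
lemma treeSum_le_one (N : ℕ) : treeSum N (10000 / 38489) ≤ 1 := by
  have hx : (0 : ℝ) ≤ 10000 / 38489 := by norm_num
  have h3 := treeSum_pow_le (y := 0.01753841) (t := 0.018185) 3 hx (by norm_num) (by norm_num)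
    (by norm_num) (by norm_num) (by norm_num)
  have h4 := treeSum_pow_le (y := 0.00455674) (t := 0.0045988) 4 hx (by norm_num) (by norm_num)
    (by norm_num) (by norm_num) (by norm_num)
  have h5 := treeSum_pow_le (y := 0.00118391) (t := 0.00118673) 5 hx (by norm_num) (by norm_num)
    (by norm_num) (by norm_num) (by norm_num)
  have h6 := treeSum_pow_le (y := 0.0003076) (t := 0.00030779) 6 hx (by norm_num) (by norm_num)
    (by norm_num) (by norm_num) (by norm_num)
  have h7 := treeSum_pow_le (y := 0.00007992) (t := 0.00007994) 7 hx (by norm_num) (by norm_num)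
    (by norm_num) (by norm_num) (by norm_num)
  have h8 := treeSum_pow_le (y := 0.00002077) (t := 0.00002078) 8 hx (by norm_num) (by norm_num)
    (by norm_num) (by norm_num) (by norm_num)
  have h2 : ∀ N, treeSum N ((10000 / 38489) ^ 2) ≤ 0.0785087 := by
    refine treeSum_le_of_exp_le 1 (E := 0.0045988 / 2 + 0.00030779 / (1 - (10000 / 38489) ^ 2))
      (by positivity) (by norm_num) (fun N => ?_) ?_
    · have h4 := h4 N
      have h6 := h6 N
      rw [Finset.sum_range_one, ← pow_mul, ← pow_mul]
      norm_num at h4 h6 ⊢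
      linarith
    · refine le_trans (mul_le_mul_of_nonneg_left (exp_le_quartic ?_ ?_) ?_) ?_ <;> norm_num
  refine treeSum_le_of_exp_le 6 (E := 0.046793856) hx (by norm_num) (fun N => ?_) ?_ N
  · have h2 := h2 N
    have h3 := h3 N
    have h4 := h4 N
    have h5 := h5 N
    have h6 := h6 N
    have h7 := h7 N
    have h8 := h8 N
    simp only [Finset.sum_range_succ, Finset.sum_range_zero]
    norm_num at h2 h3 h4 h5 h6 h7 h8 ⊢
    linarith
  · rw [Real.exp_add]
    have e1 := Real.exp_one_lt_d9.le
    have e2 := exp_le_quartic (u := 0.046793856) (by norm_num) (by norm_num)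
    have := mul_le_mul e1 e2 (Real.exp_pos _).le (by norm_num)
    refine le_trans (mul_le_mul_of_nonneg_left this (by norm_num)) ?_
    norm_num

lemma not_summable_pow_codeSize : ¬ Summable fun q => ((10000 : ℝ) / 38481) ^ codeSize q := by
  intro hs
  set x : ℝ := 10000 / 38481 with hx
  have hx0 : 0 ≤ x := by norm_num [hx]
  have hx1 : x < 1 := by norm_num [hx]
  set G : ℕ → ℝ := fun k => ∑' q, (x ^ k) ^ codeSize q with hG
  have hsk : ∀ k, 1 ≤ k → Summable fun q => (x ^ k) ^ codeSize q := fun k hk =>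
    hs.of_nonneg_of_le (fun q => by positivity)
      fun q => pow_le_pow_left₀ (by positivity) (pow_le_of_le_one hx0 hx1.le (by omega)) _
  have hG0 : ∀ k, 0 ≤ G k := fun k => tsum_nonneg fun q => by positivity
  have main : ∀ k n, 1 ≤ k → x ^ k / (1 - x ^ k) * Real.exp (∑ j ∈ Finset.range n,
      G (k * (j + 1)) / ((j : ℝ) + 1)) ≤ G k := by
    intro k n hk
    have := exp_le_tsum_pow_codeSize n (pow_nonneg hx0 k) (pow_lt_one₀ hx0 hx1 (by omega))
      (hsk k hk)
    simp_rw [show ∀ j : ℕ, (x ^ k) ^ (j + 1) = x ^ (k * (j + 1)) from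
      fun j => (pow_mul x k (j + 1)).symm] at this
    exact this
  have step : ∀ k z l e, 1 ≤ k → z ≤ x ^ k → 0 ≤ z → z < 1 → 0 ≤ e →
      e ≤ G k + G (k * 2) / 2 + G (k * 3) / 3 →
      l ≤ z / (1 - z) * (1 + e + e ^ 2 / 2 + e ^ 3 / 6) → l ≤ G k := by
    intro k z l e hk hz hz0 hz1 he0 he hl
    refine hl.trans (le_trans ?_ (main k 3 hk))
    have h1 : x ^ k < 1 := pow_lt_one₀ hx0 hx1 (by omega)
    have h2 : (1 + e + e ^ 2 / 2 + e ^ 3 / 6) ≤ Real.exp (∑ j ∈ Finset.range 3,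
        G (k * (j + 1)) / ((j : ℝ) + 1)) := by
      refine (cubic_le_exp he0).trans (Real.exp_le_exp.2 (he.trans (le_of_eq ?_)))
      norm_num [Finset.sum_range_succ]
    have h3 : 0 < 1 - x ^ k := by linarith
    have h4 : 0 ≤ 1 - z := by linarith
    gcongr
  have crude : ∀ k l z, 1 ≤ k → z ≤ x ^ k → 0 ≤ z → z < 1 → l ≤ z → l ≤ G k := by
    intro k l z hk hz hz0 hz1 hl
    refine step k z l 0 hk hz hz0 hz1 le_rfl
      (by have := hG0 k; have := hG0 (k * 2); have := hG0 (k * 3); positivity) (hl.trans ?_)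
    have : 0 < 1 - z := by linarith
    simpa using le_div_self hz0 this (by linarith)
  have g4 : (0.00460230 : ℝ) ≤ G 4 := by
    refine step 4 0.00456052 _ 0.00456052 (by norm_num) (by norm_num [hx]) (by norm_num)
      (by norm_num) (by norm_num) ?_ (by norm_num)
    have h1 := hG0 8
    have h2 := hG0 12
    have h3 := crude 4 0.00456052 0.00456052 (by norm_num) (by norm_num [hx]) (by norm_num)
      (by norm_num) le_rfl
    norm_num at h1 h2 h3 ⊢
    linarith
  have g5 : (0.00118794 : ℝ) ≤ G 5 := by
    refine step 5 0.00118513 _ 0.00118513 (by norm_num) (by norm_num [hx]) (by norm_num)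
      (by norm_num) (by norm_num) ?_ (by norm_num)
    have h1 := hG0 10
    have h2 := hG0 15
    have h3 := crude 5 0.00118513 0.00118513 (by norm_num) (by norm_num [hx]) (by norm_num)
      (by norm_num) le_rfl
    norm_num at h1 h2 h3 ⊢
    linarith
  have g6 : (0.00030815 : ℝ) ≤ G 6 := by
    refine step 6 0.00030797 _ 0.00030797 (by norm_num) (by norm_num [hx]) (by norm_num)
      (by norm_num) (by norm_num) ?_ (by norm_num)
    have h1 := hG0 12
    have h2 := hG0 18
    have h3 := crude 6 0.00030797 0.00030797 (by norm_num) (by norm_num [hx]) (by norm_num)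
      (by norm_num) le_rfl
    norm_num at h1 h2 h3 ⊢
    linarith
  have g7 : (0.00008004 : ℝ) ≤ G 7 := by
    refine step 7 0.00008003 _ 0.00008003 (by norm_num) (by norm_num [hx]) (by norm_num)
      (by norm_num) (by norm_num) ?_ (by norm_num)
    have h1 := hG0 14
    have h2 := hG0 21
    have h3 := crude 7 0.00008003 0.00008003 (by norm_num) (by norm_num [hx]) (by norm_num)
      (by norm_num) le_rfl
    norm_num at h1 h2 h3 ⊢
    linarith
  have g3 : (0.01754934 : ℝ) ≤ G 3 :=
    crude 3 0.01754934 0.01754934 (by norm_num) (by norm_num [hx]) (by norm_num) (by norm_num) le_rfl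
  replace g3 : (0.01817906 : ℝ) ≤ G 3 := by
    refine step 3 0.01754934 _ 0.01754934 (by norm_num) (by norm_num [hx]) (by norm_num)
      (by norm_num) (by norm_num) ?_ (by norm_num)
    have h1 := hG0 6
    have h2 := hG0 9
    norm_num at g6 h1 h2 ⊢
    linarith
  replace g3 : (0.01819051 : ℝ) ≤ G 3 := by
    refine step 3 0.01754934 _ 0.01817906 (by norm_num) (by norm_num [hx]) (by norm_num)
      (by norm_num) (by norm_num) ?_ (by norm_num)
    have h1 := hG0 6
    have h2 := hG0 9
    norm_num at g6 h1 h2 ⊢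
    linarith
  have g2 : (0.06753164 : ℝ) ≤ G 2 :=
    crude 2 0.06753164 0.06753164 (by norm_num) (by norm_num [hx]) (by norm_num) (by norm_num) le_rfl
  replace g2 : (0.07766858 : ℝ) ≤ G 2 := by
    refine step 2 0.06753164 _ 0.06993550 (by norm_num) (by norm_num [hx]) (by norm_num)
      (by norm_num) (by norm_num) ?_ (by norm_num)
    have h1 := hG0 4
    have h2 := hG0 6
    norm_num at g6 h1 h2 g4 ⊢
    linarith
  replace g2 : (0.07845985 : ℝ) ≤ G 2 := by
    refine step 2 0.06753164 _ 0.08007244 (by norm_num) (by norm_num [hx]) (by norm_num)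
      (by norm_num) (by norm_num) ?_ (by norm_num)
    have h1 := hG0 4
    have h2 := hG0 6
    norm_num at g6 h1 h2 g4 ⊢
    linarith
  replace g2 : (0.07852195 : ℝ) ≤ G 2 := by
    refine step 2 0.06753164 _ 0.08086371 (by norm_num) (by norm_num [hx]) (by norm_num)
      (by norm_num) (by norm_num) ?_ (by norm_num)
    have h1 := hG0 4
    have h2 := hG0 6
    norm_num at g6 h1 h2 g4 ⊢
    linarith
  have h := main 1 7 le_rfl
  have hG1 : 0 < G 1 := by
    refine lt_of_lt_of_le ?_ h
    have : 0 < x ^ 1 / (1 - x ^ 1) := by norm_num [hx]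
    positivity
  have h2 : G 1 + 0.04677543 ≤ ∑ j ∈ Finset.range 7, G (1 * (j + 1)) / ((j : ℝ) + 1) := by
    simp only [Finset.sum_range_succ, Finset.sum_range_zero]
    norm_num at g2 g3 g4 g5 g6 g7 ⊢
    linarith
  have e1 : Real.exp 1 * G 1 ≤ Real.exp (G 1) := by
    have := Real.add_one_le_exp (G 1 - 1)
    have e3 : Real.exp (G 1) = Real.exp 1 * Real.exp (G 1 - 1) := by
      rw [← Real.exp_add]
      congr 1
      ring
    rw [e3]
    exact mul_le_mul_of_nonneg_left (by linarith) (Real.exp_pos _).le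
  have e2 := cubic_le_exp (u := 0.04677543) (by norm_num)
  have e4 := Real.exp_one_gt_d9.le
  have e5 : 2.7182818283 * G 1 * (1 + 0.04677543 + 0.04677543 ^ 2 / 2 + 0.04677543 ^ 3 / 6) ≤
      Real.exp (∑ j ∈ Finset.range 7, G (1 * (j + 1)) / ((j : ℝ) + 1)) := by
    refine le_trans ?_ (Real.exp_le_exp.2 h2)
    rw [Real.exp_add]
    exact mul_le_mul ((mul_le_mul_of_nonneg_right e4 hG1.le).trans e1) e2 (by norm_num)
      (Real.exp_pos _).le
  have h6 : x ^ 1 / (1 - x ^ 1) = 10000 / 28481 := by norm_num [hx]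
  rw [h6] at h
  have h7 := (mul_le_mul_of_nonneg_left e5 (by norm_num : (0 : ℝ) ≤ 10000 / 28481)).trans h
  norm_num at h7
  nlinarith

lemma summable_pow_codeSize : Summable fun q => ((10000 : ℝ) / 38489) ^ codeSize q :=
  summable_of_sum_range_le (fun _ => by positivity) treeSum_le_one

lemma finite_codeSize_eq (n : ℕ) : {q | codeSize q = n}.Finite := by
  have h := summable_pow_codeSize.tendsto_cofinite_zero.eventually_lt_const
    (show (0 : ℝ) < (10000 / 38489) ^ n by positivity)
  rw [Filter.eventually_cofinite] at h
  refine h.subset fun q hq => ?_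
  simp only [Set.mem_ofPred_eq] at hq ⊢
  rw [hq, not_lt]

/-- The codes of the trees of total weight `n`. -/
noncomputable def treesOfSize (n : ℕ) : Finset ℕ :=
  (finite_codeSize_eq n).toFinset

@[simp] lemma mem_treesOfSize {n q : ℕ} : q ∈ treesOfSize n ↔ codeSize q = n := by
  simp [treesOfSize]

lemma card_treesOfSize_le (n : ℕ) : ((treesOfSize n).card : ℝ) ≤ 3.8489 ^ n := by
  have h1 : ∑ q ∈ treesOfSize n, ((10000 : ℝ) / 38489) ^ codeSize q ≤ 1 :=
    (summable_pow_codeSize.sum_le_tsum _ (fun _ _ => by positivity)).trans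
      (Real.tsum_le_of_sum_range_le (fun _ => by positivity) treeSum_le_one)
  have h2 : ∑ q ∈ treesOfSize n, ((10000 : ℝ) / 38489) ^ codeSize q =
      (treesOfSize n).card * (10000 / 38489) ^ n := by
    rw [← nsmul_eq_mul]
    exact Finset.sum_eq_card_nsmul fun q hq => by rw [mem_treesOfSize.1 hq]
  rw [h2, ← le_div_iff₀ (by positivity), one_div, ← inv_pow] at h1
  norm_num at h1 ⊢
  exact h1

/-- The code of the tree obtained by increasing the weight of the root. -/
def codeInc (q : ℕ) : ℕ :=
  nodeEquiv ((nodeEquiv.symm q).1 + 1, (nodeEquiv.symm q).2)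

/-- The code of the tree obtained by attaching the root of the second tree to the root of the
first one as a new child. -/
def codeGlue (q r : ℕ) : ℕ :=
  nodeEquiv ((nodeEquiv.symm q).1, r ::ₘ (nodeEquiv.symm q).2)

lemma codeInc_nodeEquiv (w : ℕ) (M : Multiset ℕ) :
    codeInc (nodeEquiv (w, M)) = nodeEquiv (w + 1, M) := by
  simp [codeInc]

lemma codeGlue_nodeEquiv (w r : ℕ) (M : Multiset ℕ) :
    codeGlue (nodeEquiv (w, M)) r = nodeEquiv (w, r ::ₘ M) := by
  simp [codeGlue]

lemma codeInc_injective : Function.Injective codeInc := by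
  intro q r h
  obtain ⟨⟨w, M⟩, rfl⟩ := nodeEquiv.surjective q
  obtain ⟨⟨w', M'⟩, rfl⟩ := nodeEquiv.surjective r
  simpa [codeInc_nodeEquiv] using h

lemma codeSize_codeInc (q : ℕ) : codeSize (codeInc q) = codeSize q + 1 := by
  obtain ⟨⟨w, M⟩, rfl⟩ := nodeEquiv.surjective q
  rw [codeInc_nodeEquiv, codeSize_nodeEquiv, codeSize_nodeEquiv]
  ring

lemma codeSize_codeGlue (q r : ℕ) : codeSize (codeGlue q r) = codeSize q + codeSize r := by
  obtain ⟨⟨w, M⟩, rfl⟩ := nodeEquiv.surjective q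
  rw [codeGlue_nodeEquiv, codeSize_nodeEquiv, codeSize_nodeEquiv]
  simp
  ring

lemma card_le_sum_map_codeSize (M : Multiset ℕ) : M.card ≤ (M.map codeSize).sum := by
  have := Multiset.card_nsmul_le_sum (s := M.map codeSize) (a := 1) (by
    intro x hx
    obtain ⟨a, _, rfl⟩ := Multiset.mem_map.1 hx
    exact codeSize_pos a)
  simpa using this

lemma card_treesOfSize_mul_le (m n : ℕ) :
    (treesOfSize m).card * (treesOfSize n).card ≤ m * (treesOfSize (m + n)).card := by
  rw [← Finset.card_product]
  refine Finset.card_le_mul_card_image_of_maps_to (f := fun p : ℕ × ℕ => codeGlue p.1 p.2)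
    (s := treesOfSize m ×ˢ treesOfSize n) ?_ m ?_
  · rintro ⟨q, r⟩ h
    simp only [Finset.mem_product, mem_treesOfSize] at h ⊢
    rw [codeSize_codeGlue, h.1, h.2]
  · intro c hc
    obtain ⟨⟨w, M⟩, rfl⟩ := nodeEquiv.surjective c
    by_cases hne : ((treesOfSize m ×ˢ treesOfSize n).filter
        fun p : ℕ × ℕ => codeGlue p.1 p.2 = nodeEquiv (w, M)).Nonempty
    · have key : ∀ q r, codeGlue q r = nodeEquiv (w, M) →
          ∃ M', q = nodeEquiv (w, M') ∧ M = r ::ₘ M' := by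
        intro q r h
        obtain ⟨⟨w', M'⟩, rfl⟩ := nodeEquiv.surjective q
        rw [codeGlue_nodeEquiv] at h
        have := nodeEquiv.injective h
        simp only [Prod.mk.injEq] at this
        exact ⟨M', by rw [this.1], this.2.symm⟩
      have hM : M.card ≤ m := by
        obtain ⟨⟨q, r⟩, h⟩ := hne
        simp only [Finset.mem_filter, Finset.mem_product, mem_treesOfSize] at h
        obtain ⟨M', rfl, rfl⟩ := key q r h.2
        rw [← h.1.1, codeSize_nodeEquiv]
        have := card_le_sum_map_codeSize M'
        simp
        omega
      refine le_trans ?_ ((Multiset.toFinset_card_le M).trans hM)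
      refine Finset.card_le_card_of_injOn Prod.snd ?_ ?_
      · rintro ⟨q, r⟩ h
        simp only [Finset.coe_filter, Set.mem_ofPred_eq] at h
        obtain ⟨M', rfl, rfl⟩ := key q r h.2
        simp
      · rintro ⟨q, r⟩ h ⟨q', r'⟩ h' hrr
        simp only [Finset.coe_filter, Set.mem_ofPred_eq] at h h' hrr
        subst hrr
        obtain ⟨M', rfl, rfl⟩ := key q r h.2
        obtain ⟨M'', rfl, h''⟩ := key q' r h'.2
        rw [Multiset.cons_inj_right] at h''
        rw [h'']
    · rw [Finset.not_nonempty_iff_eq_empty] at hne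
      rw [hne]
      simp

lemma card_treesOfSize_mono {m n : ℕ} (h : m ≤ n) :
    (treesOfSize m).card ≤ (treesOfSize n).card := by
  refine monotone_nat_of_le_succ (f := fun n => (treesOfSize n).card) (fun n => ?_) h
  refine Finset.card_le_card_of_injOn codeInc (fun q hq => ?_) codeInc_injective.injOn
  simp only [Finset.mem_coe, mem_treesOfSize] at hq ⊢
  rw [codeSize_codeInc, hq]

lemma one_le_card_treesOfSize_one : 1 ≤ (treesOfSize 1).card := by
  rw [Nat.succ_le_iff, Finset.card_pos]
  exact ⟨nodeEquiv (0, 0), by simp [codeSize_nodeEquiv]⟩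

lemma exists_lt_card_treesOfSize :
    ∃ m : ℕ, 0 < m ∧ (m : ℝ) * 3.84805 ^ m ≤ (treesOfSize m).card := by
  by_contra! hcon
  refine not_summable_pow_codeSize ?_
  have hsum : Summable fun m : ℕ => (m : ℝ) ^ 1 * (3.84805 * (10000 / 38481) : ℝ) ^ m :=
    summable_pow_mul_geometric_of_norm_lt_one 1 (by norm_num)
  refine summable_of_sum_le (c := ∑' m : ℕ, (m : ℝ) ^ 1 * (3.84805 * (10000 / 38481) : ℝ) ^ m)
    (fun _ => by positivity) fun S => ?_
  rw [← Finset.sum_fiberwise_of_maps_to (t := S.image codeSize)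
    (fun q hq => Finset.mem_image_of_mem _ hq)]
  refine le_trans (Finset.sum_le_sum fun m hm => ?_)
    (hsum.sum_le_tsum (S.image codeSize) fun _ _ => by positivity)
  have hm0 : 0 < m := by
    obtain ⟨q, _, rfl⟩ := Finset.mem_image.1 hm
    exact codeSize_pos q
  calc ∑ q ∈ S with codeSize q = m, ((10000 : ℝ) / 38481) ^ codeSize q
      = (S.filter fun q => codeSize q = m).card * (10000 / 38481) ^ m := by
        rw [← nsmul_eq_mul]
        exact Finset.sum_eq_card_nsmul fun q hq => by rw [(Finset.mem_filter.1 hq).2]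
    _ ≤ (treesOfSize m).card * (10000 / 38481) ^ m := by
        gcongr
        intro q hq
        exact mem_treesOfSize.2 (Finset.mem_filter.1 hq).2
    _ ≤ (m * 3.84805 ^ m) * (10000 / 38481) ^ m := by
        gcongr
        exact (hcon m hm0).le
    _ = _ := by rw [mul_pow, pow_one, mul_assoc]

lemma exists_mul_pow_le_card_treesOfSize :
    ∃ c : ℝ, 0 < c ∧ ∀ n : ℕ, 1 ≤ n → c * 3.84805 ^ n ≤ (treesOfSize n).card := by
  obtain ⟨m, hm, hlt⟩ := exists_lt_card_treesOfSize
  have hpow : ∀ k : ℕ, ((3.84805 : ℝ) ^ m) ^ k ≤ (treesOfSize (m * k + 1)).card := by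
    intro k
    induction k with
    | zero => simpa using one_le_card_treesOfSize_one
    | succ k ih =>
      have h1 : ((treesOfSize m).card : ℝ) * (treesOfSize (m * k + 1)).card ≤
          m * (treesOfSize (m + (m * k + 1))).card := by
        exact_mod_cast card_treesOfSize_mul_le m (m * k + 1)
      have h2 := mul_le_mul hlt ih (by positivity) (by positivity)
      have h3 : m * (k + 1) + 1 = m + (m * k + 1) := by ring
      rw [h3]
      have h4 : (0 : ℝ) < m := by exact_mod_cast hm
      refine le_of_mul_le_mul_left ?_ h4
      refine le_trans (le_of_eq ?_) (h2.trans h1)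
      ring
  refine ⟨((3.84805 : ℝ) ^ (m + 1))⁻¹, by positivity, fun n hn => ?_⟩
  rw [inv_mul_le_iff₀ (by positivity)]
  have h1 : m * ((n - 1) / m) + 1 ≤ n := by
    have := Nat.mul_div_le (n - 1) m
    omega
  have h2 : n ≤ (m + 1) + m * ((n - 1) / m) := by
    have := Nat.lt_mul_div_succ (n - 1) hm
    rw [mul_add, mul_one] at this
    omega
  calc (3.84805 : ℝ) ^ n ≤ 3.84805 ^ ((m + 1) + m * ((n - 1) / m)) :=
        pow_le_pow_right₀ (by norm_num) h2
    _ = 3.84805 ^ (m + 1) * (3.84805 ^ m) ^ ((n - 1) / m) := by rw [pow_add, pow_mul]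
    _ ≤ 3.84805 ^ (m + 1) * (treesOfSize n).card := by
        gcongr
        exact (hpow _).trans (by exact_mod_cast card_treesOfSize_mono h1)

/-- A finite vertex set with a child relation, a root, and an excess weight at every vertex. -/
structure WTree where
  U : Type
  fin : Fintype U
  child : U → U → Prop
  w : U → ℕ
  root : U

namespace WTree

instance (A : WTree) : Fintype A.U := A.fin

/-- A single vertex of excess weight zero. -/
def single : WTree where
  U := Unit
  fin := inferInstance
  child _ _ := False
  w _ := 0
  root := ()

open Classical in
/-- Increase the weight of the root by one. -/
noncomputable def inc (A : WTree) : WTree where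
  U := A.U
  fin := A.fin
  child := A.child
  w u := A.w u + if u = A.root then 1 else 0
  root := A.root

lemma inc_w_of_eq (A : WTree) (u : A.U) (h : u = A.root) : A.inc.w u = A.w u + 1 :=
  congrArg (A.w u + ·) (if_pos h)

lemma inc_w_of_ne (A : WTree) (u : A.U) (h : u ≠ A.root) : A.inc.w u = A.w u :=
  congrArg (A.w u + ·) (if_neg h)

/-- Make the root of `B` a child of the root of `A`. -/
def glue (A B : WTree) : WTree where
  U := A.U ⊕ B.U
  fin := inferInstance
  child
    | .inl a, .inl a' => A.child a a'
    | .inl a, .inr b => a = A.root ∧ b = B.root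
    | .inr _, .inl _ => False
    | .inr b, .inr b' => B.child b b'
  w := Sum.elim A.w B.w
  root := .inl A.root

/-- Attach a new leaf of excess weight `k` to the vertex `u`. -/
def addLeaf (A : WTree) (u : A.U) (k : ℕ) : WTree where
  U := Option A.U
  fin := inferInstance
  child
    | some a, some b => A.child a b
    | some a, none => a = u
    | none, _ => False
  w
    | some a => A.w a
    | none => k
  root := some A.root

/-- Isomorphism of rooted weighted trees. -/
def Iso (A B : WTree) : Prop :=
  ∃ e : A.U ≃ B.U, e A.root = B.root ∧ (∀ u v, A.child u v ↔ B.child (e u) (e v)) ∧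
    ∀ u, A.w u = B.w (e u)

namespace Iso

lemma refl (A : WTree) : Iso A A :=
  ⟨Equiv.refl _, rfl, fun _ _ => Iff.rfl, fun _ => rfl⟩

lemma symm {A B : WTree} : Iso A B → Iso B A := by
  rintro ⟨e, h1, h2, h3⟩
  exact ⟨e.symm, by rw [← h1, e.symm_apply_apply], fun u v => by simp [h2], fun u => by simp [h3]⟩

lemma trans {A B C : WTree} : Iso A B → Iso B C → Iso A C := by
  rintro ⟨e, h1, h2, h3⟩ ⟨f, g1, g2, g3⟩
  exact ⟨e.trans f, by simp [h1, g1], fun u v => by simp [h2, g2], fun u => by simp [h3, g3]⟩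

lemma inc {A B : WTree} : Iso A B → Iso A.inc B.inc := by
  rintro ⟨e, h1, h2, h3⟩
  refine ⟨e, h1, h2, fun (u : A.U) => ?_⟩
  by_cases hu : u = A.root
  · exact (A.inc_w_of_eq u hu).trans
      ((congrArg (· + 1) (h3 u)).trans (B.inc_w_of_eq (e u) (hu ▸ h1)).symm)
  · exact (A.inc_w_of_ne u hu).trans
      ((h3 u).trans (B.inc_w_of_ne (e u) fun h => hu (e.injective (h.trans h1.symm))).symm)

lemma glue {A A' B B' : WTree} : Iso A A' → Iso B B' → Iso (A.glue B) (A'.glue B') := by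
  rintro ⟨e, h1, h2, h3⟩ ⟨f, g1, g2, g3⟩
  refine ⟨Equiv.sumCongr e f, congrArg Sum.inl h1, ?_, ?_⟩
  · rintro (u | u) (v | v)
    · exact h2 u v
    · change u = A.root ∧ v = B.root ↔ e u = A'.root ∧ f v = B'.root
      rw [← h1, ← g1, e.apply_eq_iff_eq, f.apply_eq_iff_eq]
    · exact Iff.rfl
    · exact g2 u v
  · rintro (u | u)
    · exact h3 u
    · exact g3 u

end Iso

lemma iso_inc_glue (A B : WTree) : Iso (A.glue B).inc (A.inc.glue B) := by
  refine ⟨Equiv.refl (A.U ⊕ B.U), rfl, ?_, ?_⟩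
  · rintro (u | u) (v | v) <;> exact Iff.rfl
  · rintro (u | u)
    · by_cases hu : u = A.root
      · exact ((A.glue B).inc_w_of_eq (Sum.inl u) (congrArg Sum.inl hu)).trans
          (A.inc_w_of_eq u hu).symm
      · exact ((A.glue B).inc_w_of_ne (Sum.inl u) fun h => hu (Sum.inl_injective h)).trans
          (A.inc_w_of_ne u hu).symm
    · exact (A.glue B).inc_w_of_ne (Sum.inr u) Sum.inr_ne_inl

lemma iso_glue_glue (A B C : WTree) : Iso ((A.glue B).glue C) ((A.glue C).glue B) := by
  refine ⟨(Equiv.sumAssoc _ _ _).trans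
    (((Equiv.refl _).sumCongr (Equiv.sumComm _ _)).trans (Equiv.sumAssoc _ _ _).symm), rfl, ?_, ?_⟩
  · rintro ((u | u) | u) ((v | v) | v) <;>
      first
      | exact Iff.rfl
      | exact and_congr_left' Sum.inl.inj_iff
      | exact (and_congr_left' Sum.inl.inj_iff).symm
      | exact iff_of_false (fun h => Sum.inr_ne_inl h.1) id
      | exact iff_of_false id (fun h => Sum.inr_ne_inl h.1)
  · rintro ((u | u) | u) <;> rfl

lemma iso_addLeaf_inc (A : WTree) (u : A.U) (k : ℕ) :
    Iso (A.inc.addLeaf u k) (A.addLeaf u k).inc := by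
  refine ⟨Equiv.refl (Option A.U), rfl, ?_, ?_⟩
  · rintro (_ | u) (_ | v) <;> exact Iff.rfl
  · rintro (_ | v)
    · exact ((A.addLeaf u k).inc_w_of_ne none fun h => Option.some_ne_none _ h.symm).symm
    · by_cases hv : v = A.root
      · exact (A.inc_w_of_eq v hv).trans
          ((A.addLeaf u k).inc_w_of_eq (some v) (congrArg some hv)).symm
      · exact (A.inc_w_of_ne v hv).trans
          ((A.addLeaf u k).inc_w_of_ne (some v) fun h => hv (Option.some_injective _ h)).symm

lemma iso_addLeaf_inl (A B : WTree) (u : A.U) (k : ℕ) :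
    Iso ((A.glue B).addLeaf (Sum.inl u) k) ((A.addLeaf u k).glue B) := by
  let e : Option (A.U ⊕ B.U) ≃ Option A.U ⊕ B.U :=
    { toFun := fun
        | none => .inl none
        | some (.inl a) => .inl (some a)
        | some (.inr b) => .inr b
      invFun := fun
        | .inl none => none
        | .inl (some a) => some (.inl a)
        | .inr b => some (.inr b)
      left_inv := by rintro (_ | a | b) <;> rfl
      right_inv := by rintro ((_ | a) | b) <;> rfl }
  refine ⟨e, rfl, ?_, ?_⟩
  · rintro (_ | a | b) (_ | a' | b') <;>
      first
      | exact Iff.rfl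
      | exact Sum.inl.inj_iff
      | exact Sum.inr.inj_iff
      | exact iff_of_false Sum.inr_ne_inl id
      | exact iff_of_false Sum.inl_ne_inr id
      | exact and_congr_left' Option.some_inj.symm
      | exact and_congr_right' Option.some_inj.symm
      | exact iff_of_false id (fun h => Option.some_ne_none _ h.1.symm)
  · rintro (_ | a | b) <;> rfl

lemma iso_addLeaf_inr (A B : WTree) (u : B.U) (k : ℕ) :
    Iso ((A.glue B).addLeaf (Sum.inr u) k) (A.glue (B.addLeaf u k)) := by
  let e : Option (A.U ⊕ B.U) ≃ A.U ⊕ Option B.U :=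
    { toFun := fun
        | none => .inr none
        | some (.inl a) => .inl a
        | some (.inr b) => .inr (some b)
      invFun := fun
        | .inr none => none
        | .inl a => some (.inl a)
        | .inr (some b) => some (.inr b)
      left_inv := by rintro (_ | a | b) <;> rfl
      right_inv := by rintro (a | (_ | b)) <;> rfl }
  refine ⟨e, rfl, ?_, ?_⟩
  · rintro (_ | a | b) (_ | a' | b') <;>
      first
      | exact Iff.rfl
      | exact Sum.inl.inj_iff
      | exact Sum.inr.inj_iff
      | exact iff_of_false Sum.inr_ne_inl id
      | exact iff_of_false Sum.inl_ne_inr id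
      | exact and_congr_left' Option.some_inj.symm
      | exact and_congr_right' Option.some_inj.symm
      | exact iff_of_false Sum.inl_ne_inr (fun h => Option.some_ne_none _ h.2.symm)
  · rintro (_ | a | b) <;> rfl

end WTree

/-- Terms describing how a rooted weighted tree is put together. -/
inductive TreeTerm
  | single : TreeTerm
  | inc : TreeTerm → TreeTerm
  | glue : TreeTerm → TreeTerm → TreeTerm

namespace TreeTerm

/-- The tree described by a term. -/
noncomputable def toWTree : TreeTerm → WTree
  | single => WTree.single
  | inc a => a.toWTree.inc
  | glue a b => a.toWTree.glue b.toWTree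

/-- The code of the tree described by a term. -/
def code : TreeTerm → ℕ
  | single => nodeEquiv (0, 0)
  | inc a => codeInc a.code
  | glue a b => codeGlue a.code b.code

/-- The term for a single vertex of excess weight `k`. -/
def vertex : ℕ → TreeTerm
  | 0 => single
  | k + 1 => inc (vertex k)

/-- Attach the trees in a list to the root of a tree. -/
def glueList (t : TreeTerm) (l : List TreeTerm) : TreeTerm :=
  l.foldr (fun b a => glue a b) t

/-- Equivalence of terms describing isomorphic trees. -/
def Equivalent (s t : TreeTerm) : Prop :=
  WTree.Iso s.toWTree t.toWTree

lemma equivalent_inc_glueList (t : TreeTerm) (l : List TreeTerm) :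
    Equivalent (inc (glueList t l)) (glueList (inc t) l) := by
  induction l with
  | nil => exact WTree.Iso.refl _
  | cons b l ih => exact (WTree.iso_inc_glue _ _).trans (ih.glue (WTree.Iso.refl _))

lemma equivalent_glueList_of_perm (t : TreeTerm) {l l' : List TreeTerm} (h : l.Perm l') :
    Equivalent (glueList t l) (glueList t l') := by
  induction h with
  | nil => exact WTree.Iso.refl _
  | cons b _ ih => exact ih.glue (WTree.Iso.refl _)
  | swap a b l => exact WTree.iso_glue_glue _ _ _
  | trans _ _ ih1 ih2 => exact ih1.trans ih2

/-- A term for the tree with a given code. -/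
noncomputable def ofCode (q : ℕ) : TreeTerm :=
  glueList (vertex (nodeEquiv.symm q).1)
    ((nodeEquiv.symm q).2.toList.attach.map fun (a : {x // x ∈ (nodeEquiv.symm q).2.toList}) =>
      have : a.1 < q := by
        have h := lt_nodeEquiv (w := (nodeEquiv.symm q).1) (Multiset.mem_toList.1 a.2)
        simpa using h
      ofCode a.1)
termination_by q

lemma ofCode_nodeEquiv (w : ℕ) (M : Multiset ℕ) :
    ofCode (nodeEquiv (w, M)) = glueList (vertex w) (M.toList.map ofCode) := by
  rw [ofCode]
  have : ∀ p : ℕ × Multiset ℕ, p = (w, M) →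
      glueList (vertex p.1) (p.2.toList.attach.map fun a => ofCode a.1) =
        glueList (vertex w) (M.toList.map ofCode) := by
    rintro p rfl
    rw [List.attach_map_val (f := ofCode)]
  exact this _ (by simp)

lemma code_vertex (k : ℕ) : (vertex k).code = nodeEquiv (k, 0) := by
  induction k with
  | zero => rfl
  | succ k ih => rw [vertex, code, ih, codeInc_nodeEquiv]

lemma code_glueList (t : TreeTerm) (w : ℕ) (M : Multiset ℕ) (h : t.code = nodeEquiv (w, M))
    (l : List TreeTerm) :
    (glueList t l).code = nodeEquiv (w, (l.map code : List ℕ) + M) := by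
  induction l with
  | nil => simpa [glueList] using h
  | cons b l ih =>
    change codeGlue (glueList t l).code b.code = _
    rw [ih, codeGlue_nodeEquiv, List.map_cons, ← Multiset.cons_coe, Multiset.cons_add]

lemma code_ofCode (q : ℕ) : (ofCode q).code = q := by
  induction q using Nat.strong_induction_on with
  | _ q ih =>
    obtain ⟨⟨w, M⟩, rfl⟩ := nodeEquiv.surjective q
    rw [ofCode_nodeEquiv, code_glueList _ w 0 (code_vertex w), List.map_map]
    have : List.map (code ∘ ofCode) M.toList = M.toList := by
      conv_rhs => rw [← List.map_id M.toList]
      refine List.map_congr_left fun a ha => ?_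
      exact ih a (lt_nodeEquiv (Multiset.mem_toList.1 ha))
    rw [this]
    simp

lemma equivalent_ofCode_code (t : TreeTerm) : Equivalent t (ofCode t.code) := by
  induction t with
  | single =>
    rw [code, ofCode_nodeEquiv]
    rw [Multiset.toList_zero]
    exact WTree.Iso.refl _
  | inc a ih =>
    obtain ⟨⟨w, M⟩, h⟩ := nodeEquiv.surjective a.code
    rw [code, ← h, codeInc_nodeEquiv, ofCode_nodeEquiv]
    rw [← h, ofCode_nodeEquiv] at ih
    exact (WTree.Iso.inc ih).trans (equivalent_inc_glueList _ _)
  | glue a b iha ihb =>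
    obtain ⟨⟨w, M⟩, h⟩ := nodeEquiv.surjective a.code
    rw [code, ← h, codeGlue_nodeEquiv, ofCode_nodeEquiv]
    rw [← h, ofCode_nodeEquiv] at iha
    refine (WTree.Iso.glue iha ihb).trans (equivalent_glueList_of_perm (vertex w)
      (l := ofCode b.code :: M.toList.map ofCode) ?_)
    rw [← List.map_cons]
    refine List.Perm.map _ ?_
    rw [← Multiset.coe_eq_coe, ← Multiset.cons_coe, Multiset.coe_toList, Multiset.coe_toList]

lemma vertex_spec (k : ℕ) : ∃ _ : (vertex k).toWTree.U ≃ Unit,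
    (∀ a b, ¬ (vertex k).toWTree.child a b) ∧ ∀ a, (vertex k).toWTree.w a = k := by
  induction k with
  | zero => exact ⟨Equiv.refl _, fun _ _ h => h, fun _ => rfl⟩
  | succ k ih =>
    obtain ⟨e, h1, h2⟩ := ih
    refine ⟨e, h1, fun a => ?_⟩
    have : a = (vertex k).toWTree.root := e.injective rfl
    have h3 := h2 a
    exact ((vertex k).toWTree.inc_w_of_eq a this).trans (congrArg (· + 1) h3)

/-- Every tree obtained by attaching a leaf to a tree described by a term is described by a
term. -/
lemma exists_iso_addLeaf (t : TreeTerm) (u : t.toWTree.U) (k : ℕ) :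
    ∃ t' : TreeTerm, WTree.Iso (t.toWTree.addLeaf u k) t'.toWTree := by
  induction t with
  | single =>
    refine ⟨glue single (vertex k), ?_⟩
    obtain ⟨e, h1, h2⟩ := vertex_spec k
    let f : Option Unit ≃ Unit ⊕ (vertex k).toWTree.U :=
      { toFun := fun
          | none => .inr (vertex k).toWTree.root
          | some _ => .inl ()
        invFun := fun
          | .inl _ => some ()
          | .inr _ => none
        left_inv := by rintro (_ | a) <;> rfl
        right_inv := by
          rintro (_ | a)
          · rfl
          · exact congrArg Sum.inr (e.injective rfl) }
    refine ⟨f, rfl, ?_, ?_⟩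
    · rintro (_ | a) (_ | b)
      · exact iff_of_false id (h1 _ _)
      · exact Iff.rfl
      · exact iff_of_true rfl ⟨rfl, rfl⟩
      · exact Iff.rfl
    · rintro (_ | a)
      · exact (h2 _).symm
      · rfl
  | inc a ih =>
    obtain ⟨t', h⟩ := ih u
    exact ⟨inc t', (WTree.iso_addLeaf_inc _ _ _).trans h.inc⟩
  | glue a b iha ihb =>
    rcases u with u | u
    · obtain ⟨t', h⟩ := iha u
      exact ⟨glue t' b, (WTree.iso_addLeaf_inl _ _ _ _).trans (h.glue (WTree.Iso.refl _))⟩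
    · obtain ⟨t', h⟩ := ihb u
      exact ⟨glue a t', (WTree.iso_addLeaf_inr _ _ _ _).trans ((WTree.Iso.refl _).glue h)⟩

end TreeTerm

/-- A relation that is the parent-child relation of a rooted tree. -/
structure IsArbor {X : Type} (ch : X → X → Prop) (root : X) : Prop where
  not_root : ∀ u, ¬ ch u root
  exists_parent : ∀ v, v ≠ root → ∃ u, ch u v
  unique : ∀ u u' v, ch u v → ch u' v → u = u'
  exists_rank : ∃ r : X → ℕ, ∀ u v, ch u v → r u < r v

namespace IsArbor

variable {X : Type} {ch : X → X → Prop} {root : X}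

lemma not_self (h : IsArbor ch root) (u : X) : ¬ ch u u := by
  obtain ⟨r, hr⟩ := h.exists_rank
  exact fun hu => lt_irrefl _ (hr _ _ hu)

lemma adj_of (h : IsArbor ch root) {u v : X} (huv : ch u v) :
    (SimpleGraph.fromRel ch).Adj u v := by
  rw [SimpleGraph.fromRel_adj]
  refine ⟨?_, Or.inl huv⟩
  rintro rfl
  exact h.not_self _ huv

lemma adj_iff (h : IsArbor ch root) (u v : X) :
    (SimpleGraph.fromRel ch).Adj u v ↔ ch u v ∨ ch v u := by
  refine ⟨fun h1 => h1.2, ?_⟩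
  rintro (h1 | h1)
  · exact h.adj_of h1
  · exact (h.adj_of h1).symm

/-- Induction from the root along the parent-child relation. -/
lemma induction (h : IsArbor ch root) {P : X → Prop} (h0 : P root)
    (h1 : ∀ u v, ch u v → P u → P v) (v : X) : P v := by
  obtain ⟨r, hr⟩ := h.exists_rank
  induction hn : r v using Nat.strong_induction_on generalizing v with
  | _ n ih =>
    by_cases hv : v = root
    · rwa [hv]
    · obtain ⟨u, hu⟩ := h.exists_parent v hv
      exact h1 u v hu (ih (r u) (hn ▸ hr u v hu) u rfl)

lemma connected (h : IsArbor ch root) : (SimpleGraph.fromRel ch).Connected := by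
  have hr : ∀ v, (SimpleGraph.fromRel ch).Reachable root v :=
    h.induction (SimpleGraph.Reachable.refl _) fun u v huv hu => hu.trans (h.adj_of huv).reachable
  have : Nonempty X := ⟨root⟩
  exact ⟨fun u v => (hr u).symm.trans (hr v)⟩

lemma isTree [Finite X] (h : IsArbor ch root) : (SimpleGraph.fromRel ch).IsTree := by
  rw [SimpleGraph.isTree_iff_connected_and_card]
  refine ⟨h.connected, le_antisymm ?_ h.connected.card_vert_le_card_edgeSet_add_one⟩
  choose! p hp using h.exists_parent
  let f : {x // x ≠ root} → (SimpleGraph.fromRel ch).edgeSet :=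
    fun x => ⟨s(p x.1, x.1), h.adj_of (hp x.1 x.2)⟩
  have hf : Function.Surjective f := by
    rintro ⟨e, he⟩
    induction e using Sym2.ind with
    | _ u v =>
      have key : ∀ u v, ch u v → ∃ x : {x // x ≠ root}, s(p x.1, x.1) = s(u, v) := by
        intro u v huv
        have hv : v ≠ root := by
          rintro rfl
          exact h.not_root _ huv
        exact ⟨⟨v, hv⟩, by rw [h.unique _ _ _ (hp v hv) huv]⟩
      rcases (h.adj_iff u v).1 he with h1 | h1
      · obtain ⟨x, hx⟩ := key u v h1
        exact ⟨x, Subtype.ext hx⟩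
      · obtain ⟨x, hx⟩ := key v u h1
        exact ⟨x, Subtype.ext (hx.trans Sym2.eq_swap)⟩
  have := Nat.card_le_card_of_surjective f hf
  have h2 : Nat.card {x // x ≠ root} + 1 = Nat.card X := by
    have := Fintype.ofFinite X
    classical
    rw [Nat.card_eq_fintype_card, Nat.card_eq_fintype_card, Fintype.card_subtype_compl]
    have : 0 < Fintype.card X := Fintype.card_pos_iff.2 ⟨root⟩
    simp
    omega
  omega

lemma single : IsArbor WTree.single.child WTree.single.root where
  not_root _ h := h
  exists_parent _ h := (h rfl).elim
  unique _ _ _ h := h.elim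
  exists_rank := ⟨fun _ => 0, fun _ _ h => h.elim⟩

lemma glue {A B : WTree} (hA : IsArbor A.child A.root) (hB : IsArbor B.child B.root) :
    IsArbor (A.glue B).child (A.glue B).root where
  not_root := by
    rintro (u | u)
    · exact hA.not_root u
    · exact id
  exists_parent := by
    rintro (v | v) hv
    · obtain ⟨u, hu⟩ := hA.exists_parent v fun h => hv (congrArg Sum.inl h)
      exact ⟨Sum.inl u, hu⟩
    · by_cases h : v = B.root
      · exact ⟨Sum.inl A.root, rfl, h⟩
      · obtain ⟨u, hu⟩ := hB.exists_parent v h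
        exact ⟨Sum.inr u, hu⟩
  unique := by
    rintro (u | u) (u' | u') (v | v) h h'
    · exact congrArg Sum.inl (hA.unique _ _ _ h h')
    · exact congrArg Sum.inl (h.1.trans h'.1.symm)
    · exact h'.elim
    · exact (hB.not_root u' (h.2 ▸ h')).elim
    · exact h.elim
    · exact (hB.not_root u (h'.2 ▸ h)).elim
    · exact h.elim
    · exact congrArg Sum.inr (hB.unique _ _ _ h h')
  exists_rank := by
    obtain ⟨r, hr⟩ := hA.exists_rank
    obtain ⟨s, hs⟩ := hB.exists_rank
    refine ⟨Sum.elim r fun b => s b + r A.root + 1, ?_⟩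
    rintro (u | u) (v | v) h
    · exact hr u v h
    · change r u < s v + r A.root + 1
      rw [h.1]
      omega
    · exact h.elim
    · have := hs u v h
      change s u + r A.root + 1 < s v + r A.root + 1
      omega

end IsArbor

lemma TreeTerm.isArbor (t : TreeTerm) : IsArbor t.toWTree.child t.toWTree.root := by
  induction t with
  | single => exact IsArbor.single
  | inc a ih => exact ih
  | glue a b iha ihb => exact iha.glue ihb

/-- `G` arises from the tree `A` by replacing every vertex `u` by a clique of size `A.w u + 1`, and
`p` maps the vertices of these cliques to the vertices of the tree. -/
structure Models (A : WTree) {V : Type} (G : SimpleGraph V) (p : V → A.U) : Prop where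
  adj : ∀ x y, G.Adj x y ↔ x ≠ y ∧ (p x = p y ∨ A.child (p x) (p y) ∨ A.child (p y) (p x))
  card : ∀ u, Nat.card {x // p x = u} = A.w u + 1

lemma Models.comp {A : WTree} {V W : Type} {G : SimpleGraph V} {p : V → A.U} (h : Models A G p)
    (e : W ≃ V) : Models A (G.comap e) (p ∘ e) where
  adj x y := by
    rw [SimpleGraph.comap_adj, h.adj, e.injective.ne_iff]
    rfl
  card u := by
    rw [← h.card u]
    exact Nat.card_congr (e.subtypeEquiv fun _ => Iff.rfl)

lemma Models.surjective {A : WTree} {V : Type} {G : SimpleGraph V} {p : V → A.U}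
    (h : Models A G p) : Function.Surjective p := by
  intro u
  have : 0 < Nat.card {x // p x = u} := by
    rw [h.card]
    omega
  obtain ⟨⟨x, hx⟩⟩ := (Nat.card_pos_iff.1 this).1
  exact ⟨x, hx⟩

lemma Models.natCard {A : WTree} {V : Type} [Finite V] {G : SimpleGraph V} {p : V → A.U}
    (h : Models A G p) : Nat.card V = ∑ u, (A.w u + 1) := by
  rw [← Nat.card_congr (Equiv.sigmaFiberEquiv p), Nat.card_sigma]
  exact Finset.sum_congr rfl fun u _ => h.card u

lemma WTree.exists_models (A : WTree) {n : ℕ} (hn : ∑ u, (A.w u + 1) = n) :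
    ∃ (G : SimpleGraph (Fin n)) (p : Fin n → A.U), Models A G p := by
  let G : SimpleGraph (Σ u : A.U, Fin (A.w u + 1)) :=
    SimpleGraph.fromRel fun x y => x.1 = y.1 ∨ A.child x.1 y.1
  have h : Models A G Sigma.fst := by
    refine ⟨fun x y => ?_, fun u => ?_⟩
    · rw [SimpleGraph.fromRel_adj, eq_comm (a := y.1)]
      tauto
    · rw [Nat.card_congr (Equiv.sigmaSubtype u)]
      simp
  have e : Fin n ≃ Σ u : A.U, Fin (A.w u + 1) :=
    (Fintype.equivFinOfCardEq (by simp [hn])).symm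
  exact ⟨_, _, h.comp e⟩

lemma WTree.Iso.nonempty_iso {A B : WTree} (h : WTree.Iso A B) {V W : Type} [Finite V] [Finite W]
    {G : SimpleGraph V} {G' : SimpleGraph W} {p : V → A.U} {p' : W → B.U} (hG : Models A G p)
    (hG' : Models B G' p') : Nonempty (G ≃g G') := by
  obtain ⟨e, -, h2, h3⟩ := h
  have f : ∀ u, Nonempty ({x // p x = u} ≃ {x // p' x = e u}) := fun u =>
    ⟨(Finite.equivFinOfCardEq (hG.card u)).trans
      (Finite.equivFinOfCardEq ((hG'.card (e u)).trans (by rw [h3]))).symm⟩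
  let g : V ≃ W := (Equiv.sigmaFiberEquiv p).symm.trans
    ((Equiv.sigmaCongr e fun u => (f u).some).trans (Equiv.sigmaFiberEquiv p'))
  have hg : ∀ x, p' (g x) = e (p x) := fun x => ((f (p x)).some ⟨x, rfl⟩).2
  refine ⟨g, fun {x y} => ?_⟩
  rw [hG.adj, hG'.adj, hg, hg, g.injective.ne_iff, e.injective.eq_iff, h2, h2]

lemma TreeTerm.sum_w (t : TreeTerm) : ∑ u, (t.toWTree.w u + 1) = codeSize t.code := by
  induction t with
  | single =>
    rw [TreeTerm.code, codeSize_nodeEquiv]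
    exact Fintype.sum_unique (ι := Unit) _
  | inc a ih =>
    classical
    rw [TreeTerm.code, codeSize_codeInc, ← ih]
    have h : ∀ u : a.toWTree.U, a.toWTree.inc.w u + 1 =
        (a.toWTree.w u + 1) + if u = a.toWTree.root then 1 else 0 := by
      intro u
      split_ifs with hu
      · rw [a.toWTree.inc_w_of_eq u hu]
      · rw [a.toWTree.inc_w_of_ne u hu]
    refine (Finset.sum_congr (s₁ := (Finset.univ : Finset a.toWTree.U)) rfl fun u _ => h u).trans ?_
    rw [Finset.sum_add_distrib]
    simp
  | glue a b iha ihb =>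
    rw [TreeTerm.code, codeSize_codeGlue, ← iha, ← ihb]
    exact Fintype.sum_sum_type (α₁ := a.toWTree.U) (α₂ := b.toWTree.U) _

lemma dist_le_three_iff {X : Type} {T : SimpleGraph X} (hT : T.Connected) {a b pa pb : X}
    (hab : a ≠ b) (ha : ∀ v, T.Adj a v ↔ v = pa) (hb : ∀ v, T.Adj b v ↔ v = pb) :
    T.dist a b ≤ 3 ↔ pa = pb ∨ T.Adj pa pb := by
  have ha' := (ha pa).2 rfl
  have hb' := ((hb pb).2 rfl).symm
  constructor
  · intro h
    obtain ⟨p, hp⟩ := hT.exists_walk_length_eq_dist a b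
    rw [← hp] at h
    cases p with
    | nil => exact (hab rfl).elim
    | cons h1 p =>
      obtain rfl := (ha _).1 h1
      cases p with
      | nil =>
        right
        obtain rfl := (hb _).1 h1.symm
        exact h1.symm
      | cons h2 p =>
        cases p with
        | nil => exact Or.inl ((hb _).1 h2.symm)
        | cons h3 p =>
          cases p with
          | nil =>
            obtain rfl := (hb _).1 h3.symm
            exact Or.inr h2
          | cons h4 p =>
            simp only [SimpleGraph.Walk.length_cons] at h
            omega
  · rintro (rfl | h)
    · exact (SimpleGraph.dist_le (.cons ha' (.cons hb' .nil))).trans (by simp)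
    · exact (SimpleGraph.dist_le (.cons ha' (.cons h (.cons hb' .nil)))).trans (by simp)

namespace Models

variable {A : WTree} {V : Type} {G : SimpleGraph V} {p : V → A.U}

lemma connected (h : Models A G p) (hA : IsArbor A.child A.root) : G.Connected := by
  obtain ⟨x0, hx0⟩ := h.surjective A.root
  have hadj : ∀ x y, (p x = p y ∨ A.child (p x) (p y)) → G.Reachable x y := by
    intro x y hxy
    by_cases hne : x = y
    · rw [hne]
    · exact ((h.adj x y).2 ⟨hne, hxy.imp_right Or.inl⟩).reachable
  have key : ∀ u, ∀ x, p x = u → G.Reachable x0 x := by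
    refine hA.induction (fun x hx => hadj _ _ (Or.inl (hx0.trans hx.symm))) ?_
    intro u v huv ih y hy
    obtain ⟨x, hx⟩ := h.surjective u
    exact (ih x hx).trans (hadj x y (Or.inr (by rwa [hx, hy])))
  have : Nonempty V := ⟨x0⟩
  exact ⟨fun x y => (key _ x rfl).symm.trans (key _ y rfl)⟩

/-- The tree `A` with every vertex of the modelled graph attached as a leaf. -/
def leafChild (A : WTree) {V : Type} (p : V → A.U) : A.U ⊕ V → A.U ⊕ V → Prop
  | .inl u, .inl v => A.child u v
  | .inl u, .inr x => p x = u
  | .inr _, _ => False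

lemma isArbor_leafChild (hA : IsArbor A.child A.root) (p : V → A.U) :
    IsArbor (leafChild A p) (Sum.inl A.root) where
  not_root := by
    rintro (u | x)
    · exact hA.not_root u
    · exact id
  exists_parent := by
    rintro (v | x) hv
    · obtain ⟨u, hu⟩ := hA.exists_parent v fun h => hv (congrArg Sum.inl h)
      exact ⟨Sum.inl u, hu⟩
    · exact ⟨Sum.inl (p x), rfl⟩
  unique := by
    rintro (u | u) (u' | u') (v | v) h h'
    · exact congrArg Sum.inl (hA.unique _ _ _ h h')
    · exact congrArg Sum.inl (h.symm.trans h')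
    all_goals first | exact h.elim | exact h'.elim
  exists_rank := by
    obtain ⟨r, hr⟩ := hA.exists_rank
    refine ⟨Sum.elim r fun x => r (p x) + 1, ?_⟩
    rintro (u | u) (v | v) h
    · exact hr u v h
    · have h : p v = u := h
      change r u < r (p v) + 1
      rw [h]
      omega
    · exact h.elim
    · exact h.elim

lemma isThreeLeafPower [Finite V] [Nontrivial V] (h : Models A G p)
    (hA : IsArbor A.child A.root) : IsThreeLeafPower G := by
  have hL := isArbor_leafChild hA p
  obtain ⟨m, ⟨e⟩⟩ := Finite.exists_equiv_fin (A.U ⊕ V)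
  let T : SimpleGraph (Fin m) := (SimpleGraph.fromRel (leafChild A p)).comap e.symm
  have hT : T.IsTree := (SimpleGraph.Iso.isTree_iff (SimpleGraph.Iso.comap e.symm _)).2 hL.isTree
  have hadj : ∀ a b, T.Adj (e a) (e b) ↔ leafChild A p a b ∨ leafChild A p b a := by
    intro a b
    rw [SimpleGraph.comap_adj, e.symm_apply_apply, e.symm_apply_apply, hL.adj_iff]
  have hleaf : ∀ x v, T.Adj (e (Sum.inr x)) v ↔ v = e (Sum.inl (p x)) := by
    intro x v
    obtain ⟨v, rfl⟩ := e.surjective v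
    rw [hadj, e.apply_eq_iff_eq]
    rcases v with v | y
    · exact (false_or _).to_iff.trans (eq_comm.trans Sum.inl.inj_iff.symm)
    · exact iff_of_false (fun h => h.elim id id) Sum.inr_ne_inl
  refine ⟨m, T, hT, fun x => e (Sum.inr x), fun x y hxy => Sum.inr_injective (e.injective hxy),
    fun x => ⟨_, (hleaf x _).2 rfl, fun v hv => (hleaf x v).1 hv⟩, ?_, ?_⟩
  · intro a
    obtain ⟨u | x, rfl⟩ := e.surjective a
    · rintro ⟨b, -, hb⟩
      exfalso
      obtain ⟨x, rfl⟩ := h.surjective u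
      obtain ⟨y, hxy⟩ := (h.connected hA).preconnected.exists_adj_of_nontrivial x
      have h1 := hb (e (Sum.inr x)) ((hadj _ _).2 (Or.inl rfl))
      obtain ⟨hne, hp | hp⟩ := (h.adj x y).1 hxy
      · have h2 := hb (e (Sum.inr y)) ((hadj _ _).2 (Or.inl hp.symm))
        exact hne (Sum.inr_injective (e.injective (h1.trans h2.symm)))
      · have h2 := hb (e (Sum.inl (p y))) ((hadj _ _).2 hp)
        exact Sum.inr_ne_inl (e.injective (h1.trans h2.symm))
    · exact fun _ => ⟨x, rfl⟩
  · intro x y hxy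
    rw [dist_le_three_iff hT.connected (fun h' => hxy (Sum.inr_injective (e.injective h')))
      (hleaf x) (hleaf y), h.adj, hadj, e.apply_eq_iff_eq, Sum.inl.inj_iff]
    exact and_iff_right hxy

end Models

/-- Every finite tree with weights on its vertices is described by a term. -/
lemma exists_treeTerm_of_isTree (n : ℕ) : ∀ {X : Type} [Finite X] (H : SimpleGraph X),
    Nat.card X = n → H.IsTree → ∀ w : X → ℕ,
    ∃ (t : TreeTerm) (e : t.toWTree.U ≃ X), (∀ a b, H.Adj (e a) (e b) ↔
      t.toWTree.child a b ∨ t.toWTree.child b a) ∧ ∀ a, w (e a) = t.toWTree.w a := by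
  induction n with
  | zero =>
    intro X _ H hn hH w
    have := hH.connected.nonempty
    exact (Nat.card_pos.ne' hn).elim
  | succ n ih =>
    intro X _ H hn hH w
    rcases subsingleton_or_nontrivial X with hX | hX
    · obtain ⟨x⟩ := hH.connected.nonempty
      obtain ⟨e, h1, h2⟩ := TreeTerm.vertex_spec (w x)
      refine ⟨TreeTerm.vertex (w x), e.trans (@Equiv.ofUnique Unit X _
        ⟨⟨x⟩, fun _ => Subsingleton.elim _ _⟩), fun a b => ?_, fun a => ?_⟩
      · refine iff_of_false (fun h => h.ne (Subsingleton.elim _ _)) ?_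
        rintro (h | h)
        · exact h1 _ _ h
        · exact h1 _ _ h
      · rw [h2]
        exact congrArg w (Subsingleton.elim _ _)
    · classical
      have := Fintype.ofFinite X
      obtain ⟨v, hv⟩ := hH.exists_vert_degree_one_of_nontrivial
      have hH' : (H.induce {v}ᶜ).IsTree :=
        ⟨hH.connected.induce_compl_singleton_of_degree_eq_one hv, hH.isAcyclic.induce _⟩
      obtain ⟨u, hu, hu'⟩ := SimpleGraph.degree_eq_one_iff_existsUnique_adj.1 hv
      have hcard : Nat.card ({v}ᶜ : Set X) = n := by
        rw [Nat.card_coe_set_eq, Set.ncard_compl, Set.ncard_singleton, hn]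
        rfl
      obtain ⟨t, e, h1, h2⟩ := ih (H.induce {v}ᶜ) hcard hH' fun x => w x.1
      have huv : u ∈ ({v}ᶜ : Set X) := fun h => hu.ne h.symm
      obtain ⟨t', f, -, f2, f3⟩ := t.exists_iso_addLeaf (e.symm ⟨u, huv⟩) (w v)
      let g : Option t.toWTree.U → X := fun
        | none => v
        | some a => (e a).1
      have hg : Function.Bijective g := by
        constructor
        · rintro (_ | a) (_ | b) hab
          · rfl
          · exact ((e b).2 hab.symm).elim
          · exact ((e a).2 hab).elim
          · exact congrArg some (e.injective (Subtype.ext hab))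
        · intro x
          by_cases hx : x = v
          · exact ⟨none, hx.symm⟩
          · exact ⟨some (e.symm ⟨x, hx⟩), congrArg Subtype.val (e.apply_symm_apply ⟨x, hx⟩)⟩
      have hgn : ∀ a, H.Adj v (e a).1 ↔ a = e.symm ⟨u, huv⟩ := by
        intro a
        rw [Equiv.eq_symm_apply, Subtype.ext_iff]
        exact ⟨fun h => hu' _ h, fun h => by rw [h]; exact hu⟩
      refine ⟨t', f.symm.trans (Equiv.ofBijective g hg), ?_, ?_⟩
      · intro a b
        obtain ⟨a, rfl⟩ := f.surjective a
        obtain ⟨b, rfl⟩ := f.surjective b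
        rw [← f2, ← f2]
        change H.Adj (g (f.symm (f a))) (g (f.symm (f b))) ↔ _
        rw [f.symm_apply_apply, f.symm_apply_apply]
        rcases a with _ | a <;> rcases b with _ | b
        · exact iff_of_false (fun h => h.ne rfl) (fun h => h.elim id id)
        · exact (hgn b).trans (false_or _).to_iff.symm
        · exact (H.adj_comm _ _).trans ((hgn a).trans (or_false _).to_iff.symm)
        · exact h1 a b
      · intro a
        obtain ⟨a, rfl⟩ := f.surjective a
        rw [← f3]
        change w (g (f.symm (f a))) = _
        rw [f.symm_apply_apply]
        rcases a with _ | a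
        · rfl
        · exact h2 a

/-- Every connected 3-leaf power is modelled by a tree. -/
lemma IsThreeLeafPower.exists_models {V : Type} [Finite V] {G : SimpleGraph V} (hG : G.Connected)
    (h : IsThreeLeafPower G) : ∃ (t : TreeTerm) (p : V → t.toWTree.U), Models t.toWTree G p := by
  obtain ⟨m, T, hT, f, hf, hleaf, -, hadj⟩ := h
  choose q hq hq' using hleaf
  have hq2 : ∀ x v, T.Adj (f x) v ↔ v = q x := fun x v =>
    ⟨fun h => hq' x v h, fun h => by rw [h]; exact hq x⟩
  have hG2 : ∀ x y, G.Adj x y ↔ x ≠ y ∧ (q x = q y ∨ T.Adj (q x) (q y)) := by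
    intro x y
    by_cases hxy : x = y
    · simp [hxy]
    · rw [hadj x y hxy, dist_le_three_iff hT.connected (hf.ne hxy) (hq2 x) (hq2 y)]
      exact (and_iff_right hxy).symm
  let r : V → Set.range q := fun x => ⟨q x, x, rfl⟩
  let H : SimpleGraph (Set.range q) := T.induce (Set.range q)
  have hreach : ∀ x y, G.Reachable x y → H.Reachable (r x) (r y) := by
    rintro x y ⟨w⟩
    induction w with
    | nil => exact SimpleGraph.Reachable.refl _
    | cons hxy _ ih =>
      refine SimpleGraph.Reachable.trans ?_ ih
      rcases ((hG2 _ _).1 hxy).2 with h1 | h1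
      · rw [show r _ = r _ from Subtype.ext h1]
      · exact SimpleGraph.Adj.reachable (G := H) h1
  have hH : H.IsTree := by
    refine ⟨?_, hT.isAcyclic.induce _⟩
    obtain ⟨x⟩ := hG.nonempty
    have : Nonempty (Set.range q) := ⟨r x⟩
    refine ⟨?_⟩
    rintro ⟨_, x, rfl⟩ ⟨_, y, rfl⟩
    exact hreach x y (hG.preconnected x y)
  obtain ⟨t, e, h1, h2⟩ := exists_treeTerm_of_isTree _ H rfl hH
    fun u => Nat.card {x // r x = u} - 1
  refine ⟨t, fun x => e.symm (r x), fun x y => ?_, fun u => ?_⟩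
  · rw [hG2, ← h1, e.apply_symm_apply, e.apply_symm_apply, e.symm.apply_eq_iff_eq, Subtype.ext_iff]
    rfl
  · rw [← h2]
    have h3 : 0 < Nat.card {x // r x = e u} := by
      obtain ⟨x, hx⟩ := (e u).2
      have : Nonempty {x // r x = e u} := ⟨⟨x, Subtype.ext hx⟩⟩
      exact Nat.card_pos
    rw [Nat.sub_add_cancel h3]
    exact Nat.card_congr (Equiv.subtypeEquivRight fun x => e.symm_apply_eq)

lemma numConn3LP_le_card_treesOfSize (n : ℕ) : numConn3LP n ≤ (treesOfSize n).card := by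
  classical
  have key : ∀ G : {G : SimpleGraph (Fin n) // G.Connected ∧ IsThreeLeafPower G},
      ∃ t : TreeTerm, ∃ p, Models t.toWTree G.1 p := fun G => G.2.2.exists_models G.2.1
  choose t p ht using key
  have hmem : ∀ G, (t G).code ∈ treesOfSize n := by
    intro G
    rw [mem_treesOfSize, ← TreeTerm.sum_w, ← (ht G).natCard, Nat.card_fin]
  have hinj : Function.Injective fun Q : Quot
      (fun (G G' : {G : SimpleGraph (Fin n) // G.Connected ∧ IsThreeLeafPower G}) =>
        Nonempty (G.val ≃g G'.val)) => (⟨(t Q.out).code, hmem _⟩ : treesOfSize n) := by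
    intro Q Q' h
    have h1 : (t Q.out).code = (t Q'.out).code := congrArg Subtype.val h
    have h2 : WTree.Iso (t Q.out).toWTree (t Q'.out).toWTree :=
      (TreeTerm.equivalent_ofCode_code (t Q.out)).trans
        (h1 ▸ (TreeTerm.equivalent_ofCode_code (t Q'.out)).symm)
    rw [← Quot.out_eq Q, ← Quot.out_eq Q']
    exact Quot.sound (h2.nonempty_iso (ht _) (ht _))
  have := Nat.card_le_card_of_injective _ hinj
  rwa [Nat.card_eq_fintype_card (α := treesOfSize n), Fintype.card_coe] at this

/-- The function `c` gives the codes of the subtrees at the vertices of `A`. -/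
def HasCodes (A : WTree) (c : A.U → ℕ) : Prop :=
  ∀ u, ∃ S : Finset A.U, (∀ v, v ∈ S ↔ A.child u v) ∧ c u = nodeEquiv (A.w u, S.val.map c)

lemma HasCodes.eq_of_iso {A B : WTree} {c : A.U → ℕ} {d : B.U → ℕ} (hc : HasCodes A c)
    (hd : HasCodes B d) (e : A.U ≃ B.U) (h2 : ∀ u v, A.child u v ↔ B.child (e u) (e v))
    (h3 : ∀ u, A.w u = B.w (e u)) (u : A.U) : c u = d (e u) := by
  induction hn : c u using Nat.strong_induction_on generalizing u with
  | _ n ih =>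
    subst hn
    obtain ⟨S, hS, hcu⟩ := hc u
    obtain ⟨R, hR, hdu⟩ := hd (e u)
    have hRS : R = S.map e.toEmbedding := by
      ext v
      obtain ⟨v, rfl⟩ := e.surjective v
      rw [hR, ← h2, ← hS, Finset.mem_map_equiv, e.symm_apply_apply]
    rw [hcu, hdu, hRS, h3, Finset.map_val, Multiset.map_map]
    congr 2
    refine Multiset.map_congr rfl fun v hv => ?_
    refine ih (c v) ?_ v rfl
    rw [hcu]
    exact lt_nodeEquiv (Multiset.mem_map_of_mem c hv)

lemma TreeTerm.exists_hasCodes (t : TreeTerm) :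
    ∃ c, HasCodes t.toWTree c ∧ c t.toWTree.root = t.code := by
  classical
  induction t with
  | single =>
    refine ⟨fun _ => nodeEquiv (0, 0), fun u => ⟨∅, fun v => ?_, rfl⟩, rfl⟩
    exact iff_of_false (Finset.notMem_empty v) id
  | inc a ih =>
    obtain ⟨c, hc, hroot⟩ := ih
    let c' : a.toWTree.U → ℕ := fun u => if u = a.toWTree.root then codeInc (c u) else c u
    refine ⟨c', fun (u : a.toWTree.U) => ?_, (if_pos rfl).trans (congrArg codeInc hroot)⟩
    obtain ⟨S, hS, hcu⟩ := hc u
    refine ⟨S, hS, ?_⟩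
    have hmap : S.val.map c' = S.val.map c := by
      refine Multiset.map_congr rfl fun v hv => if_neg ?_
      rintro rfl
      exact a.isArbor.not_root u ((hS _).1 hv)
    refine Eq.trans ?_ (congrArg (fun M => nodeEquiv (a.toWTree.inc.w u, M)) hmap.symm)
    by_cases hu : u = a.toWTree.root
    · refine (if_pos hu).trans ?_
      rw [hcu, codeInc_nodeEquiv, a.toWTree.inc_w_of_eq u hu]
    · refine (if_neg hu).trans ?_
      rw [hcu, a.toWTree.inc_w_of_ne u hu]
  | glue a b iha ihb =>
    obtain ⟨c, hc, hcr⟩ := iha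
    obtain ⟨d, hd, hdr⟩ := ihb
    let c' : a.toWTree.U → ℕ :=
      fun u => if u = a.toWTree.root then codeGlue (c u) b.code else c u
    refine ⟨Sum.elim c' d, ?_, (if_pos rfl).trans (congrArg (codeGlue · b.code) hcr)⟩
    have hmap : ∀ S : Finset a.toWTree.U, ∀ R : Finset b.toWTree.U,
        (∀ v ∈ S, ∃ u, a.toWTree.child u v) →
        (S.disjSum R).val.map (Sum.elim c' d) = S.val.map c + R.val.map d := by
      intro S R h
      rw [Finset.val_disjSum, Multiset.disjSum, Multiset.map_add, Multiset.map_map,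
        Multiset.map_map]
      refine congrArg₂ _ (Multiset.map_congr rfl fun v hv => if_neg ?_) rfl
      rintro rfl
      obtain ⟨u, hu⟩ := h _ hv
      exact a.isArbor.not_root u hu
    rintro (u | u)
    · obtain ⟨S, hS, hcu⟩ := hc u
      have hS' : ∀ v ∈ S, ∃ u, a.toWTree.child u v := fun v hv => ⟨u, (hS v).1 hv⟩
      by_cases hu : u = a.toWTree.root
      · refine ⟨S.disjSum {b.toWTree.root}, ?_, ?_⟩
        · rintro (v | v)
          · exact Finset.inl_mem_disjSum.trans (hS v)
          · refine Finset.inr_mem_disjSum.trans (Finset.mem_singleton.trans ?_)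
            exact ⟨fun h => ⟨hu, h⟩, fun h => h.2⟩
        · refine Eq.trans ?_ (congrArg (fun M => nodeEquiv (a.toWTree.w u, M)) (hmap S _ hS').symm)
          refine (if_pos hu).trans ?_
          rw [hcu, codeGlue_nodeEquiv, Finset.singleton_val, Multiset.map_singleton, hdr,
            add_comm, Multiset.singleton_add]
      · refine ⟨S.disjSum ∅, ?_, ?_⟩
        · rintro (v | v)
          · exact Finset.inl_mem_disjSum.trans (hS v)
          · refine Finset.inr_mem_disjSum.trans ?_
            exact iff_of_false (Finset.notMem_empty v) fun h => hu h.1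
        · refine Eq.trans ?_ (congrArg (fun M => nodeEquiv (a.toWTree.w u, M)) (hmap S _ hS').symm)
          refine (if_neg hu).trans ?_
          rw [hcu, Finset.empty_val, Multiset.map_zero, add_zero]
    · obtain ⟨S, hS, hdu⟩ := hd u
      refine ⟨(∅ : Finset a.toWTree.U).disjSum S, ?_, ?_⟩
      · rintro (v | v)
        · refine Finset.inl_mem_disjSum.trans ?_
          exact iff_of_false (Finset.notMem_empty v) id
        · exact Finset.inr_mem_disjSum.trans (hS v)
      · refine Eq.trans ?_ (congrArg (fun M => nodeEquiv (b.toWTree.w u, M)) (hmap ∅ S ?_).symm)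
        · refine hdu.trans ?_
          rw [Finset.empty_val, Multiset.map_zero, zero_add]
        · exact fun v hv => (Finset.notMem_empty v hv).elim

lemma TreeTerm.code_eq_of_equivalent {s t : TreeTerm} (h : Equivalent s t) : s.code = t.code := by
  obtain ⟨c, hc, hcr⟩ := s.exists_hasCodes
  obtain ⟨d, hd, hdr⟩ := t.exists_hasCodes
  obtain ⟨e, h1, h2, h3⟩ := h
  rw [← hcr, ← hdr, hc.eq_of_iso hd e h2 h3, h1]

/-- If the root of a rooted tree has two children, adjacent vertices are distinguished by a third
vertex. -/
lemma IsArbor.exists_distinguishing {X : Type} {ch : X → X → Prop} {root : X}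
    (h : IsArbor ch root) (hroot : ∀ v, ∃ z, z ≠ v ∧ ch root z) {u v : X} (huv : ch u v) :
    ∃ z, z ≠ u ∧ z ≠ v ∧ (ch z u ∨ ch u z) ∧ ¬ (ch z v ∨ ch v z) := by
  obtain ⟨r, hr⟩ := h.exists_rank
  by_cases hu : u = root
  · obtain ⟨z, hzv, hz⟩ := hroot v
    rw [← hu] at hz
    refine ⟨z, ?_, hzv, Or.inr hz, ?_⟩
    · rintro rfl
      exact h.not_self _ hz
    · rintro (h1 | h1)
      · obtain rfl := h.unique _ _ _ h1 huv
        exact h.not_self _ hz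
      · obtain rfl := h.unique _ _ _ h1 hz
        exact h.not_self _ huv
  · obtain ⟨z, hz⟩ := h.exists_parent u hu
    have h1 := hr _ _ hz
    have h2 := hr _ _ huv
    refine ⟨z, ?_, ?_, Or.inl hz, ?_⟩
    · rintro rfl
      omega
    · rintro rfl
      omega
    · rintro (h3 | h3)
      · obtain rfl := h.unique _ _ _ h3 huv
        exact h.not_self _ hz
      · have := hr _ _ h3
        omega

namespace Models

variable {A B : WTree} {V W : Type} {G : SimpleGraph V} {G' : SimpleGraph W} {p : V → A.U}
  {p' : W → B.U}

/-- The cliques of a modelled graph are its classes of twins. -/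
lemma apply_eq_apply_iff (h : Models A G p) (hA : IsArbor A.child A.root)
    (hroot : ∀ v, ∃ z, z ≠ v ∧ A.child A.root z) (x y : V) :
    p x = p y ↔ x = y ∨ (G.Adj x y ∧ ∀ z, z ≠ x → z ≠ y → (G.Adj z x ↔ G.Adj z y)) := by
  constructor
  · intro hxy
    by_cases hne : x = y
    · exact Or.inl hne
    · refine Or.inr ⟨(h.adj x y).2 ⟨hne, Or.inl hxy⟩, fun z hzx hzy => ?_⟩
      rw [h.adj, h.adj, hxy]
      exact and_congr (iff_of_true hzx hzy) Iff.rfl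
  · have key : ∀ x y, A.child (p x) (p y) →
        ¬ ∀ z, z ≠ x → z ≠ y → (G.Adj z x ↔ G.Adj z y) := by
      intro x y hxy hz
      obtain ⟨u, h1, h2, h3, h4⟩ := hA.exists_distinguishing hroot hxy
      obtain ⟨z, rfl⟩ := h.surjective u
      have hzx : z ≠ x := fun h => h1 (congrArg p h)
      have hzy : z ≠ y := fun h => h2 (congrArg p h)
      have := ((hz z hzx hzy).1 ((h.adj z x).2 ⟨hzx, Or.inr h3⟩))
      rcases ((h.adj z y).1 this).2 with h5 | h5
      · exact h2 h5
      · exact h4 h5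
    rintro (hxy | ⟨hxy, hz⟩)
    · rw [hxy]
    · rcases ((h.adj x y).1 hxy).2 with h5 | h5 | h5
      · exact h5
      · exact (key x y h5 hz).elim
      · exact (key y x h5 fun z h1 h2 => (hz z h2 h1).symm).elim

/-- A graph isomorphism respecting the root cliques comes from an isomorphism of rooted trees. -/
lemma iso_of_iso (hG : Models A G p) (hG' : Models B G' p') (hA : IsArbor A.child A.root)
    (hB : IsArbor B.child B.root) (hAr : ∀ v, ∃ z, z ≠ v ∧ A.child A.root z)
    (hBr : ∀ v, ∃ z, z ≠ v ∧ B.child B.root z) (φ : G ≃g G') {x : V} (hx : p x = A.root)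
    (hx' : p' (φ x) = B.root) : WTree.Iso A B := by
  have htwin : ∀ x y, p x = p y ↔ p' (φ x) = p' (φ y) := by
    intro x y
    rw [hG.apply_eq_apply_iff hA hAr, hG'.apply_eq_apply_iff hB hBr, φ.map_adj_iff,
      φ.injective.eq_iff]
    refine or_congr_right (and_congr_right fun _ => ⟨fun h z hzx hzy => ?_, fun h z hzx hzy => ?_⟩)
    · obtain ⟨z, rfl⟩ := φ.surjective z
      rw [φ.map_adj_iff, φ.map_adj_iff]
      exact h z (fun h => hzx (congrArg φ h)) (fun h => hzy (congrArg φ h))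
    · have := h (φ z) (φ.injective.ne hzx) (φ.injective.ne hzy)
      rwa [φ.map_adj_iff, φ.map_adj_iff] at this
  choose s hs using hG.surjective
  have he : ∀ x, p' (φ (s (p x))) = p' (φ x) := fun x => (htwin _ _).1 (hs _)
  let e : A.U ≃ B.U := Equiv.ofBijective (fun u => p' (φ (s u))) (by
    constructor
    · intro u v huv
      have := (htwin _ _).2 huv
      rwa [hs, hs] at this
    · intro v
      obtain ⟨y, rfl⟩ := hG'.surjective v
      obtain ⟨x, rfl⟩ := φ.surjective y
      exact ⟨p x, he x⟩)
  have he : ∀ x, e (p x) = p' (φ x) := he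
  have hadj : ∀ u v, A.child u v ∨ A.child v u ↔ B.child (e u) (e v) ∨ B.child (e v) (e u) := by
    intro u v
    by_cases huv : u = v
    · rw [huv, or_self, or_self]
      exact iff_of_false (hA.not_self _) (hB.not_self _)
    · obtain ⟨x, rfl⟩ := hG.surjective u
      obtain ⟨y, rfl⟩ := hG.surjective v
      have hne : x ≠ y := fun h => huv (congrArg p h)
      have h1 := hG.adj x y
      have h2 := hG'.adj (φ x) (φ y)
      rw [φ.map_adj_iff, φ.injective.ne_iff, ← htwin, ← he, ← he, h1] at h2
      tauto
  have horient : ∀ u v, A.child u v → B.child (e u) (e v) := by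
    refine hA.induction ?_ ?_
    · intro v hv
      rcases (hadj _ _).1 (Or.inl hv) with h1 | h1
      · exact h1
      · rw [← hx, he, hx'] at h1
        exact (hB.not_root _ h1).elim
    · intro u v huv ih z hz
      rcases (hadj _ _).1 (Or.inl hz) with h1 | h1
      · exact h1
      · have h2 := e.injective (hB.unique _ _ _ h1 (ih v huv))
        obtain ⟨r, hr⟩ := hA.exists_rank
        have h3 := hr _ _ hz
        have h4 := hr _ _ huv
        rw [h2] at h3
        omega
  refine ⟨e, by rw [← hx, he, hx'], fun u v => ⟨horient u v, fun h => ?_⟩, fun u => ?_⟩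
  · rcases (hadj _ _).2 (Or.inl h) with h1 | h1
    · exact h1
    · obtain ⟨r, hr⟩ := hB.exists_rank
      have h3 := hr _ _ h
      have h4 := hr _ _ (horient _ _ h1)
      omega
  · have h1 := hG.card u
    have h2 := hG'.card (e u)
    have h3 : Nat.card {x // p x = u} = Nat.card {y // p' y = e u} := by
      refine Nat.card_congr (φ.toEquiv.subtypeEquiv fun x => ?_)
      rw [← e.apply_eq_iff_eq, he]
      rfl
    omega

end Models

lemma codeGlue_left_injective (r : ℕ) : Function.Injective fun q => codeGlue q r := by
  intro q q' h
  obtain ⟨⟨w, M⟩, rfl⟩ := nodeEquiv.surjective q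
  obtain ⟨⟨w', M'⟩, rfl⟩ := nodeEquiv.surjective q'
  simp only [codeGlue_nodeEquiv, nodeEquiv.apply_eq_iff_eq, Prod.mk.injEq,
    Multiset.cons_inj_right] at h
  rw [h.1, h.2]

lemma exists_iso_out {n : ℕ} (G : {G : SimpleGraph (Fin n) // G.Connected ∧ IsThreeLeafPower G}) :
    Nonempty (G.val ≃g (Quot.mk (fun (G G' : {G : SimpleGraph (Fin n) //
      G.Connected ∧ IsThreeLeafPower G}) => Nonempty (G.val ≃g G'.val)) G).out.val) := by
  have hequiv : Equivalence (fun (G G' : {G : SimpleGraph (Fin n) //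
      G.Connected ∧ IsThreeLeafPower G}) => Nonempty (G.val ≃g G'.val)) :=
    ⟨fun _ => ⟨SimpleGraph.Iso.refl⟩, fun ⟨φ⟩ => ⟨φ.symm⟩, fun ⟨φ⟩ ⟨ψ⟩ => ⟨φ.trans ψ⟩⟩
  rw [← hequiv.eqvGen_iff]
  exact Quot.eqvGen_exact (Quot.out_eq _).symm

lemma card_treesOfSize_le_mul_numConn3LP (n : ℕ) :
    (treesOfSize n).card ≤ numConn3LP (n + 2) * (n + 2) := by
  let T : ℕ → TreeTerm := fun q => .glue (.glue (TreeTerm.ofCode q) .single) .single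
  have hsum : ∀ q : treesOfSize n, ∑ u, ((T q).toWTree.w u + 1) = n + 2 := by
    intro q
    have h0 : codeSize (nodeEquiv (0, 0)) = 1 := by simp [codeSize_nodeEquiv]
    rw [TreeTerm.sum_w]
    simp only [T, TreeTerm.code, codeSize_codeGlue, TreeTerm.code_ofCode,
      mem_treesOfSize.1 q.2, h0]
  have hroot : ∀ q v, ∃ z, z ≠ v ∧ (T q).toWTree.child (T q).toWTree.root z := by
    intro q v
    by_cases hv : v = Sum.inr ()
    · exact ⟨Sum.inl (Sum.inr ()), fun h => Sum.inl_ne_inr (h.trans hv), rfl, rfl⟩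
    · exact ⟨Sum.inr (), fun h => hv h.symm, rfl, rfl⟩
  choose G p hG using fun q : treesOfSize n => (T q).toWTree.exists_models (hsum q)
  choose x hx using fun q : treesOfSize n => (hG q).surjective (T q).toWTree.root
  let G' : treesOfSize n → {G : SimpleGraph (Fin (n + 2)) // G.Connected ∧ IsThreeLeafPower G} :=
    fun q => ⟨G q, (hG q).connected (T q).isArbor, (hG q).isThreeLeafPower (T q).isArbor⟩
  have φ := fun q => (exists_iso_out (G' q)).some
  have hinj : Function.Injective fun q : treesOfSize n =>
      (Quot.mk (fun (G G' : {G : SimpleGraph (Fin (n + 2)) // G.Connected ∧ IsThreeLeafPower G}) =>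
        Nonempty (G.val ≃g G'.val)) (G' q), φ q (x q)) := by
    intro q q' h
    have h1 := (Prod.mk.inj h).1
    have h2 : ∃ ψ : G q ≃g G q', ψ (x q) = x q' := by
      have h3 := (Prod.mk.inj h).2
      generalize φ q = a at h3
      generalize φ q' = b at h3
      revert a b
      rw [h1]
      intro a b h3
      refine ⟨a.trans b.symm, ?_⟩
      change b.symm (a (x q)) = x q'
      rw [h3, RelIso.symm_apply_apply]
    obtain ⟨ψ, hψ⟩ := h2
    have h3 := (hG q).iso_of_iso (hG q') (T q).isArbor (T q').isArbor (hroot q) (hroot q') ψ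
      (hx q) (by rw [hψ]; exact hx q')
    have h4 := TreeTerm.code_eq_of_equivalent h3
    have h5 := codeGlue_left_injective _ (codeGlue_left_injective _ h4)
    rw [TreeTerm.code_ofCode, TreeTerm.code_ofCode] at h5
    exact Subtype.ext h5
  have := Nat.card_le_card_of_injective _ hinj
  rwa [Nat.card_eq_fintype_card (α := treesOfSize n), Fintype.card_coe, Nat.card_prod,
    Nat.card_fin] at this

theorem numConn3LP_asymptotics :
    ∃ (c C : ℝ), 0 < c ∧ 0 < C ∧ ∃ N : ℕ, ∀ n : ℕ, N ≤ n →
      c * 3.848 ^ n * (n : ℝ) ^ (-(5 : ℝ) / 2) ≤ (numConn3LP n : ℝ) ∧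
      (numConn3LP n : ℝ) ≤ C * 3.849 ^ n * (n : ℝ) ^ (-(5 : ℝ) / 2) := by
  obtain ⟨c, hc, hlow⟩ := exists_mul_pow_le_card_treesOfSize
  have htend : ∀ r : ℝ, 0 ≤ r → r < 1 → ∀ᶠ n : ℕ in Filter.atTop, (n : ℝ) ^ 3 * r ^ n ≤ 1 :=
    fun r h0 h1 => (tendsto_pow_const_mul_const_pow_of_lt_one 3 h0 h1).eventually_le_const one_pos
  have h1 := htend (3.848 / 3.84805) (by norm_num) (by norm_num)
  have h2 := htend (3.8489 / 3.849) (by norm_num) (by norm_num)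
  obtain ⟨N, hN⟩ := Filter.eventually_atTop.1 ((h1.and h2).and (Filter.eventually_ge_atTop 3))
  refine ⟨c / 3.84805 ^ 2, 1, by positivity, one_pos, N, fun n hn => ?_⟩
  obtain ⟨⟨h1, h2⟩, h3⟩ := hN n hn
  have hn1 : (1 : ℝ) ≤ n := by exact_mod_cast (by omega : 1 ≤ n)
  have hn0 : (0 : ℝ) < n := by linarith
  constructor
  · obtain ⟨m, rfl⟩ : ∃ m, n = m + 2 := ⟨n - 2, by omega⟩
    have hm : 1 ≤ m := by omega
    have h4 : ((treesOfSize m).card : ℝ) ≤ numConn3LP (m + 2) * ((m + 2 : ℕ) : ℝ) := by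
      exact_mod_cast card_treesOfSize_le_mul_numConn3LP m
    have h5 := hlow m hm
    have h6 : (((m + 2 : ℕ) : ℝ)) ^ (-(5 : ℝ) / 2) ≤ 1 :=
      Real.rpow_le_one_of_one_le_of_nonpos hn1 (by norm_num)
    generalize ((m + 2 : ℕ) : ℝ) = x at *
    rw [div_pow, mul_div_assoc', div_le_one (by positivity)] at h1
    have hx : x ≤ x ^ 3 := le_self_pow₀ hn1 (by norm_num)
    have h7 : x * 3.848 ^ (m + 2) ≤ (3.84805 : ℝ) ^ (m + 2) :=
      (mul_le_mul_of_nonneg_right hx (by positivity)).trans h1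
    calc c / 3.84805 ^ 2 * 3.848 ^ (m + 2) * x ^ (-(5 : ℝ) / 2)
        ≤ c / 3.84805 ^ 2 * 3.848 ^ (m + 2) * 1 :=
          mul_le_mul_of_nonneg_left h6 (by positivity)
      _ ≤ numConn3LP (m + 2) := by
          refine le_of_mul_le_mul_right ?_ hn0
          refine le_trans ?_ (h5.trans h4)
          calc c / 3.84805 ^ 2 * 3.848 ^ (m + 2) * 1 * x
              = c / 3.84805 ^ 2 * (x * 3.848 ^ (m + 2)) := by ring
            _ ≤ c / 3.84805 ^ 2 * 3.84805 ^ (m + 2) :=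
                mul_le_mul_of_nonneg_left h7 (by positivity)
            _ = c * 3.84805 ^ m := by
                rw [pow_add]
                field_simp
  · have h4 : (numConn3LP n : ℝ) ≤ 3.8489 ^ n :=
      le_trans (by exact_mod_cast numConn3LP_le_card_treesOfSize n) (card_treesOfSize_le n)
    refine h4.trans ?_
    have h5 : ((n : ℝ) ^ 3)⁻¹ ≤ (n : ℝ) ^ (-(5 : ℝ) / 2) := by
      rw [← Real.rpow_natCast, ← Real.rpow_neg hn0.le]
      exact Real.rpow_le_rpow_of_exponent_le hn1 (by norm_num)
    rw [div_pow, mul_div_assoc', div_le_one (by positivity)] at h2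
    calc (3.8489 : ℝ) ^ n = (n : ℝ) ^ 3 * 3.8489 ^ n * ((n : ℝ) ^ 3)⁻¹ := by field_simp
      _ ≤ 3.849 ^ n * ((n : ℝ) ^ 3)⁻¹ := mul_le_mul_of_nonneg_right h2 (by positivity)
      _ ≤ 1 * 3.849 ^ n * (n : ℝ) ^ (-(5 : ℝ) / 2) := by
          rw [one_mul]
          exact mul_le_mul_of_nonneg_left h5 (by positivity)
end
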